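/- Let P ⊂ ℝ^d be a belt polytope with face poset ℱ (all faces including the empty face, ordered by inclusion) and let L_0 be the poset of flats L(P) with a new minimal element ∅ adjoined below {0}; let L : ℱ → L_0 be the map F ↦ L(F), with L(∅) = ∅. For every cone angle α on ℝ^d, the interior angle function α̂ and the exterior angle function α̌ (extended to the empty face as specified) are elements of I_L(ℱ), and their pushforwards satisfy L_* α̌ = ζ_{L_0} and L_* α̂' = μ_{L_0}, where α̂'(F,G) = (−1)^{dim G − dim F} α̂(F,G). -/

import Mathlib

open scoped BigOperators InnerProductSpace Pointwise

noncomputable section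

/-- Euclidean space `ℝ^d`. -/
abbrev Euc (d : ℕ) : Type := EuclideanSpace ℝ (Fin d)

namespace GramAngles

variable {d : ℕ}

/-- The conical (positive) hull of a set. -/
def posHull (S : Set (Euc d)) : Set (Euc d) :=
  {u | ∃ c : ℝ, ∃ p ∈ S, 0 ≤ c ∧ u = c • p}

/-- The dimension of a set: the rank of the linear subspace parallel to its affine hull. -/
def sdim (S : Set (Euc d)) : ℕ := Module.finrank ℝ (vectorSpan ℝ S)

/-- A polyhedral cone with apex at the origin: a finitely generated convex cone. -/
def IsPolyhedralCone (C : Set (Euc d)) : Prop :=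
  ∃ (n : ℕ) (v : Fin n → Euc d),
    C = {x | ∃ c : Fin n → ℝ, (∀ i, 0 ≤ c i) ∧ x = ∑ i, c i • v i}

/-- A cone angle on `ℝ^d`: a simple, normalized valuation on polyhedral cones. -/
structure ConeAngle (d : ℕ) where
  toFun : Set (Euc d) → ℝ
  zero' : toFun {0} = 0
  union' : ∀ C C' : Set (Euc d), IsPolyhedralCone C → IsPolyhedralCone C' →
    IsPolyhedralCone (C ∪ C') → IsPolyhedralCone (C ∩ C') →
    toFun (C ∪ C') = toFun C + toFun C' - toFun (C ∩ C')
  simple' : ∀ C : Set (Euc d), IsPolyhedralCone C → sdim C < d → toFun C = 0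
  norm' : toFun Set.univ = 1

/-- A (convex) polytope: the convex hull of a nonempty finite point set. -/
def IsPolytope (P : Set (Euc d)) : Prop :=
  ∃ s : Finset (Euc d), s.Nonempty ∧ P = convexHull ℝ (s : Set (Euc d))

/-- Faces of a polytope are its exposed subsets (including `∅` and `P` itself). -/
def IsFace (P F : Set (Euc d)) : Prop := IsExposed ℝ P F

open Classical in
/-- A chosen point in the relative interior of `F`. -/
def relPt (F : Set (Euc d)) : Euc d :=
  if h : (intrinsicInterior ℝ F).Nonempty then h.some else 0

/-- The tangent (inner) cone `T_F G = cone(-q + G) + L(G)^⊥`, `q ∈ relint F`. -/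
def innerCone (F G : Set (Euc d)) : Set (Euc d) :=
  posHull ((fun x => x - relPt F) '' G) + (((vectorSpan ℝ G)ᗮ : Submodule ℝ (Euc d)) : Set (Euc d))

/-- The normal cone `N_F G` of `G` at a face `F`. -/
def normalCone (F G : Set (Euc d)) : Set (Euc d) :=
  {c | ∀ x ∈ F, ∀ y ∈ G, ⟪c, y⟫_ℝ ≤ ⟪c, x⟫_ℝ}

/-- The outer cone `O_F G = N_F G + L(F)`. -/
def outerCone (F G : Set (Euc d)) : Set (Euc d) :=
  normalCone F G + ((vectorSpan ℝ F : Submodule ℝ (Euc d)) : Set (Euc d))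

/-- Interior angle of `G` at its face `F`, measured by the cone angle `α`. -/
def intAngle (α : ConeAngle d) (F G : Set (Euc d)) : ℝ := α.toFun (innerCone F G)

/-- Exterior angle of `G` at its face `F`, measured by the cone angle `α`. -/
def extAngle (α : ConeAngle d) (F G : Set (Euc d)) : ℝ := α.toFun (outerCone F G)

/-- `α̂_i(P)`: sum of interior angles over all `i`-dimensional (nonempty) faces of `P`. -/
def intAngleSum (α : ConeAngle d) (P : Set (Euc d)) (i : ℕ) : ℝ :=
  ∑ᶠ F ∈ {F : Set (Euc d) | IsFace P F ∧ F.Nonempty ∧ sdim F = i}, intAngle α F P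

/-- `α̌_i(P)`: sum of exterior angles over all `i`-dimensional (nonempty) faces of `P`. -/
def extAngleSum (α : ConeAngle d) (P : Set (Euc d)) (i : ℕ) : ℝ :=
  ∑ᶠ F ∈ {F : Set (Euc d) | IsFace P F ∧ F.Nonempty ∧ sdim F = i}, extAngle α F P

/-- A zonotope: a translate of a Minkowski sum of finitely many segments. -/
def IsZonotope (Z : Set (Euc d)) : Prop :=
  ∃ (t : Euc d) (n : ℕ) (z : Fin n → Euc d),
    Z = {x | ∃ l : Fin n → ℝ, (∀ i, |l i| ≤ 1) ∧ x = t + ∑ i, l i • z i}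

/-- The face of `P` on which the linear functional `⟪c, ·⟫` is maximized. -/
def maxFace (P : Set (Euc d)) (c : Euc d) : Set (Euc d) :=
  {x ∈ P | ∀ y ∈ P, ⟪c, y⟫_ℝ ≤ ⟪c, x⟫_ℝ}

/-- A belt polytope: a polytope whose normal fan is the fan induced by a central
hyperplane arrangement (two functionals maximize the same face iff they have the
same sign pattern with respect to the arrangement). -/
def IsBeltPolytope (P : Set (Euc d)) : Prop :=
  IsPolytope P ∧ ∃ (k : ℕ) (z : Fin k → Euc d), (∀ i, z i ≠ 0) ∧
    ∀ c c' : Euc d,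
      ((∀ i, Real.sign ⟪z i, c⟫_ℝ = Real.sign ⟪z i, c'⟫_ℝ) ↔ maxFace P c = maxFace P c')

/-- The set of flats of a polytope: linear subspaces parallel to nonempty faces,
ordered by inclusion (as a subtype of `Submodule ℝ (Euc d)`). -/
def Flats (P : Set (Euc d)) : Set (Submodule ℝ (Euc d)) :=
  {L | ∃ F : Set (Euc d), IsFace P F ∧ F.Nonempty ∧ L = vectorSpan ℝ F}

/-- Strictly increasing chains from `a` to `c` in a poset, encoded as lists. -/
def chainsFromTo {β : Type*} [Preorder β] (a c : β) : Set (List β) :=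
  {l | l.Chain' (· < ·) ∧ l.head? = some a ∧ l.getLast? = some c}

/-- The Möbius function of a poset, via Philip Hall's chain formula. -/
def mob {β : Type*} [Preorder β] (a c : β) : ℝ :=
  ∑ᶠ l ∈ chainsFromTo a c, (-1 : ℝ) ^ (l.length + 1)

/-- Whitney numbers of the first kind of a ranked poset with minimum `bot`. -/
def whitney1 {β : Type*} [Preorder β] (rk : β → ℕ) (bot : β) (i : ℕ) : ℝ :=
  ∑ᶠ a ∈ {a : β | rk a = i}, mob bot a

/-- Flag-Whitney numbers of the second kind: the number of chains with rank set `S`. -/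
def flagW2 {β : Type*} [Preorder β] (rk : β → ℕ) (S : Finset ℕ) : ℕ :=
  Nat.card {l : List β // l.Chain' (· < ·) ∧ l.map rk = S.sort (· ≤ ·)}

/-- Flag-Whitney numbers of the first kind:
`w_S = Σ μ(0̂,c₁) μ(c₁,c₂) ⋯ μ(c_{k-1},c_k)` over chains with rank set `S`. -/
def flagW1 {β : Type*} [Preorder β] (rk : β → ℕ) (bot : β) (S : Finset ℕ) : ℝ :=
  ∑ᶠ l ∈ {l : List β | l.Chain' (· < ·) ∧ l.map rk = S.sort (· ≤ ·)},
    (List.zipWith mob (bot :: l) l).prod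

/-- Chains of nonempty faces of `P` whose dimensions are exactly the set `S`. -/
def faceChains (P : Set (Euc d)) (S : Finset ℕ) : Set (List (Set (Euc d))) :=
  {l | (∀ F ∈ l, IsFace P F ∧ F.Nonempty) ∧ l.Chain' (· ⊂ ·) ∧ l.map sdim = S.sort (· ≤ ·)}

/-- The interior flag-angle `α̂_S(P) = Σ α̂(F₁,F₂) α̂(F₂,F₃) ⋯ α̂(F_k,P)`. -/
def intFlag (α : ConeAngle d) (P : Set (Euc d)) (S : Finset ℕ) : ℝ :=
  ∑ᶠ l ∈ faceChains P S, (List.zipWith (intAngle α) l (l.drop 1 ++ [P])).prod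

/-- The exterior flag-angle `α̌_S(P) = Σ α̌(F₁,F₂) α̌(F₂,F₃) ⋯ α̌(F_k,P)`. -/
def extFlag (α : ConeAngle d) (P : Set (Euc d)) (S : Finset ℕ) : ℝ :=
  ∑ᶠ l ∈ faceChains P S, (List.zipWith (extAngle α) l (l.drop 1 ++ [P])).prod

/-- Membership in the incidence algebra: vanishing off the order relation. -/
def memIA {β : Type*} [Preorder β] (h : β → β → ℝ) : Prop :=
  ∀ a c, ¬ a ≤ c → h a c = 0

/-- Convolution product of the incidence algebra. -/
def conv {β : Type*} [Preorder β] (g h : β → β → ℝ) (a c : β) : ℝ :=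
  ∑ᶠ (b : β) (_ : a ≤ b ∧ b ≤ c), g a b * h b c

/-- The product `∗_k`, summing over middle elements of rank `k`. -/
def convk {β : Type*} (rk : β → ℕ) (k : ℕ) (g h : β → β → ℝ) (a c : β) : ℝ :=
  ∑ᶠ (b : β) (_ : rk b = k), g a b * h b c

/-- The pushforward `φ_* h (q,q') = |φ⁻¹(q')|⁻¹ Σ_{p ∈ φ⁻¹(q), p' ∈ φ⁻¹(q')} h(p,p')`. -/
def pushf {β γ : Type*} (φ : β → γ) (h : β → β → ℝ) (q q' : γ) : ℝ :=
  (Nat.card {p : β // φ p = q'} : ℝ)⁻¹ *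
    ∑ᶠ (p : β) (_ : φ p = q) (p' : β) (_ : φ p' = q'), h p p'

/-- The subspace `I_φ(𝒫)`: elements whose fiberwise column sums are independent of
the representative of the target fiber. -/
def memIphi {β γ : Type*} [Preorder β] (φ : β → γ) (h : β → β → ℝ) : Prop :=
  memIA h ∧ ∀ (q : γ) (p₁ p₂ : β), φ p₁ = φ p₂ →
    (∑ᶠ (p : β) (_ : φ p = q), h p p₁) = (∑ᶠ (p : β) (_ : φ p = q), h p p₂)

open Classical in
/-- The pullback `φ^* g (p,p') = g(φ p, φ p')` for `p ≤ p'`, else `0`. -/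
def pullb {β γ : Type*} [Preorder β] (φ : β → γ) (g : γ → γ → ℝ) (p p' : β) : ℝ :=
  if p ≤ p' then g (φ p) (φ p') else 0

open Classical in
/-- The identity `δ` of the incidence algebra. -/
def deltaIA {β : Type*} (a c : β) : ℝ := if a = c then 1 else 0

end GramAngles

namespace GramAngles

variable {d : ℕ}

/-- The poset of flats of `P` with a new minimal element `∅` adjoined (flats are taken
as subsets of `ℝ^d`, ordered by inclusion; `∅` lies below the flat `{0}`). -/
def Flats0 (P : Set (Euc d)) : Type _ :=
  {A : Set (Euc d) // A = ∅ ∨ ∃ F : Set (Euc d), IsFace P F ∧ F.Nonempty ∧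
    A = ((vectorSpan ℝ F : Submodule ℝ (Euc d)) : Set (Euc d))}

instance (P : Set (Euc d)) : PartialOrder (Flats0 P) :=
  Subtype.partialOrder _

open Classical in
/-- The map `F ↦ L(F)` from the face poset to `Flats0`, sending `∅ ↦ ∅`. -/
def LMap (P : Set (Euc d)) (F : {F : Set (Euc d) // IsFace P F}) : Flats0 P :=
  if h : F.1 = ∅ then ⟨∅, Or.inl rfl⟩
  else ⟨((vectorSpan ℝ F.1 : Submodule ℝ (Euc d)) : Set (Euc d)),
    Or.inr ⟨F.1, F.2, Set.nonempty_iff_ne_empty.2 h, rfl⟩⟩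

open Classical in
/-- The interior angle as an element of the incidence algebra of the face poset,
extended by `α̂(∅,G) = 1` if `dim G ≤ 0` and `0` otherwise. -/
def intA (α : ConeAngle d) (P : Set (Euc d))
    (F G : {F : Set (Euc d) // IsFace P F}) : ℝ :=
  if F.1 ⊆ G.1 then
    (if F.1 = ∅ then (if sdim G.1 ≤ 0 then 1 else 0) else intAngle α F.1 G.1)
  else 0

open Classical in
/-- The exterior angle as an element of the incidence algebra of the face poset,
extended by `α̌(∅,G) = 1` for all `G`. -/
def extA (α : ConeAngle d) (P : Set (Euc d))
    (F G : {F : Set (Euc d) // IsFace P F}) : ℝ :=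
  if F.1 ⊆ G.1 then (if F.1 = ∅ then 1 else extAngle α F.1 G.1) else 0

open Classical in
/-- The rank of a face in the face poset: `dim F + 1`, with the empty face of rank 0. -/
def rkFace (F : Set (Euc d)) : ℕ := if F = ∅ then 0 else sdim F + 1

/-- The signed interior angle `α̂'(F,G) = (-1)^{dim G - dim F} α̂(F,G)`. -/
def intA' (α : ConeAngle d) (P : Set (Euc d))
    (F G : {F : Set (Euc d) // IsFace P F}) : ℝ :=
  (-1 : ℝ) ^ (rkFace G.1 - rkFace F.1) * intA α P F G

/-- Cones given by finitely many linear inequalities. -/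
def IsH (C : Set (Euc d)) : Prop := ∃ A : Finset (Euc d), C = {x | ∀ a ∈ A, 0 ≤ ⟪a, x⟫_ℝ}

open Classical in
/-- Fourier–Motzkin step. -/
lemma isH_add_ray {C : Set (Euc d)} (hC : IsH C) (u : Euc d) :
    IsH {x | ∃ t : ℝ, 0 ≤ t ∧ x - t • u ∈ C} := by
  obtain ⟨A, rfl⟩ := hC
  refine ⟨A.filter (fun a => 0 ≤ ⟪a, u⟫_ℝ) ∪
    ((A.filter (fun a => 0 < ⟪a, u⟫_ℝ)) ×ˢ (A.filter (fun a => ⟪a, u⟫_ℝ < 0))).image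
      (fun p => ⟪p.1, u⟫_ℝ • p.2 - ⟪p.2, u⟫_ℝ • p.1), ?_⟩
  ext x
  simp only [Set.mem_ofPred_eq, inner_sub_right, inner_smul_right]
  constructor
  · rintro ⟨t, ht, h⟩ a ha
    rw [Finset.mem_union] at ha
    rcases ha with ha | ha
    · rw [Finset.mem_filter] at ha
      have := h a ha.1
      nlinarith [mul_nonneg ht ha.2]
    · rw [Finset.mem_image] at ha
      obtain ⟨⟨a, b⟩, hab, rfl⟩ := ha
      rw [Finset.mem_product, Finset.mem_filter, Finset.mem_filter] at hab
      obtain ⟨⟨ha, ha'⟩, hb, hb'⟩ := hab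
      have h1 := h a ha
      have h2 := h b hb
      simp only [inner_sub_left, real_inner_smul_left] at *
      nlinarith [mul_nonneg ha'.le h2, mul_nonneg (neg_nonneg.2 hb'.le) h1]
  · intro h
    have hpos : ∀ a ∈ A, 0 ≤ ⟪a, u⟫_ℝ → 0 ≤ ⟪a, x⟫_ℝ := fun a ha h0 =>
      h a (Finset.mem_union_left _ (Finset.mem_filter.2 ⟨ha, h0⟩))
    have hpair : ∀ a ∈ A, ∀ b ∈ A, 0 < ⟪a, u⟫_ℝ → ⟪b, u⟫_ℝ < 0 →
        0 ≤ ⟪a, u⟫_ℝ * ⟪b, x⟫_ℝ - ⟪b, u⟫_ℝ * ⟪a, x⟫_ℝ := by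
      intro a ha b hb ha' hb'
      have := h _ (Finset.mem_union_right _ (Finset.mem_image.2 ⟨(a, b), Finset.mem_product.2
        ⟨Finset.mem_filter.2 ⟨ha, ha'⟩, Finset.mem_filter.2 ⟨hb, hb'⟩⟩, rfl⟩))
      simpa only [inner_sub_left, real_inner_smul_left] using this
    by_cases hne : (A.filter (fun a => ⟪a, u⟫_ℝ < 0)).Nonempty
    · obtain ⟨b, hb, hmax⟩ := Finset.exists_max_image _ (fun a => ⟪a, x⟫_ℝ / ⟪a, u⟫_ℝ) hne
      rw [Finset.mem_filter] at hb
      refine ⟨max 0 (⟪b, x⟫_ℝ / ⟪b, u⟫_ℝ), le_max_left _ _, ?_⟩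
      intro a ha
      rcases lt_trichotomy ⟪a, u⟫_ℝ 0 with h0 | h0 | h0
      · have := (hmax a (Finset.mem_filter.2 ⟨ha, h0⟩)).trans (le_max_right 0 _)
        rw [div_le_iff_of_neg h0] at this
        linarith
      · rw [h0]; simpa using hpos a ha h0.ge
      · have h1 := hpair a ha b hb.1 h0 hb.2
        have h2 := hpos a ha h0.le
        have : max 0 (⟪b, x⟫_ℝ / ⟪b, u⟫_ℝ) ≤ ⟪a, x⟫_ℝ / ⟪a, u⟫_ℝ := by
          apply max_le (by positivity)
          rw [div_le_iff_of_neg hb.2, div_mul_eq_mul_div, div_le_iff₀ h0]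
          linarith
        rw [le_div_iff₀ h0] at this
        linarith
    · refine ⟨0, le_rfl, fun a ha => ?_⟩
      have h0 : 0 ≤ ⟪a, u⟫_ℝ := by
        by_contra hcon
        exact hne ⟨a, Finset.mem_filter.2 ⟨ha, not_le.1 hcon⟩⟩
      simpa using hpos a ha h0

lemma isH_add_cone {C : Set (Euc d)} (hC : IsH C) (n : ℕ) : ∀ (v : Fin n → Euc d),
    IsH {x | ∃ c : Fin n → ℝ, (∀ i, 0 ≤ c i) ∧ x - ∑ i, c i • v i ∈ C} := by
  induction n with
  | zero =>
    intro v
    convert hC using 1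
    ext x
    simp
  | succ n ih =>
    intro v
    convert isH_add_ray (ih (fun i => v i.succ)) (v 0) using 1
    ext x
    simp only [Set.mem_ofPred_eq]
    constructor
    · rintro ⟨c, hc, h⟩
      refine ⟨c 0, hc 0, fun i => c i.succ, fun i => hc _, ?_⟩
      rw [Fin.sum_univ_succ] at h
      convert h using 1
      abel
    · rintro ⟨t, ht, c, hc, h⟩
      refine ⟨Fin.cons t c, fun i => ?_, ?_⟩
      · refine Fin.cases ?_ ?_ i
        · simpa using ht
        · simpa using hc
      · rw [Fin.sum_univ_succ]
        simp only [Fin.cons_zero, Fin.cons_succ]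
        convert h using 1
        abel

open Classical in
lemma isH_inter {C D : Set (Euc d)} (hC : IsH C) (hD : IsH D) : IsH (C ∩ D) := by
  obtain ⟨A, rfl⟩ := hC
  obtain ⟨B, rfl⟩ := hD
  refine ⟨A ∪ B, ?_⟩
  ext x
  simp only [Set.mem_inter_iff, Set.mem_ofPred_eq, Finset.mem_union]
  constructor
  · rintro ⟨h1, h2⟩ a (ha | ha)
    exacts [h1 a ha, h2 a ha]
  · intro h
    exact ⟨fun a ha => h a (Or.inl ha), fun a ha => h a (Or.inr ha)⟩

lemma isH_half (v : Euc d) : IsH {x | 0 ≤ ⟪v, x⟫_ℝ} := ⟨{v}, by simp⟩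

lemma isH_univ : IsH (Set.univ : Set (Euc d)) := ⟨∅, by simp⟩

open Classical in
lemma isH_orth (W : Submodule ℝ (Euc d)) : IsH ((Wᗮ : Submodule ℝ (Euc d)) : Set (Euc d)) := by
  obtain ⟨S, hS⟩ := (inferInstance : IsNoetherian ℝ (Euc d)).noetherian W
  refine ⟨S ∪ S.image (fun x => -x), ?_⟩
  ext x
  simp only [Set.mem_ofPred_eq, SetLike.mem_coe, Submodule.mem_orthogonal, Finset.mem_union]
  constructor
  · intro h a ha
    rcases ha with ha | ha
    · rw [h a (hS ▸ Submodule.subset_span ha)]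
    · obtain ⟨b, hb, rfl⟩ := Finset.mem_image.1 ha
      rw [inner_neg_left, h b (hS ▸ Submodule.subset_span hb)]; simp
  · intro h u hu
    rw [← hS] at hu
    induction hu using Submodule.span_induction with
    | mem y hy =>
      have h1 := h y (Or.inl hy)
      have h2 := h (-y) (Or.inr (Finset.mem_image.2 ⟨y, hy, rfl⟩))
      rw [inner_neg_left] at h2
      linarith
    | zero => simp
    | add a b _ _ ha hb => rw [inner_add_left, ha, hb, add_zero]
    | smul c a _ ha => rw [real_inner_smul_left, ha, mul_zero]

lemma isH_zero : IsH ({0} : Set (Euc d)) := by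
  have := isH_orth (⊤ : Submodule ℝ (Euc d))
  simpa using this

lemma isH_cone {n : ℕ} (v : Fin n → Euc d) :
    IsH {x | ∃ c : Fin n → ℝ, (∀ i, 0 ≤ c i) ∧ x = ∑ i, c i • v i} := by
  have := isH_add_cone isH_zero n v
  simpa [sub_eq_zero] using this

lemma poly_of_isH {C : Set (Euc d)} (hC : IsH C) : IsPolyhedralCone C := by
  classical
  obtain ⟨A, rfl⟩ := hC
  let eA := A.equivFin.symm
  obtain ⟨B, hB⟩ := isH_cone (fun i => (eA i : Euc d))
  let eB := B.equivFin.symm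
  refine ⟨B.card, fun i => (eB i : Euc d), ?_⟩
  obtain ⟨D, hD⟩ := isH_cone (fun i => (eB i : Euc d))
  have gen : ∀ {m : ℕ} (w : Fin m → Euc d) (j : Fin m),
      w j ∈ {x | ∃ c : Fin m → ℝ, (∀ i, 0 ≤ c i) ∧ x = ∑ i, c i • w i} := by
    intro m w j
    refine ⟨fun i => if i = j then 1 else 0, fun i => by dsimp only; split_ifs <;> norm_num, by simp⟩
  have hAB : ∀ a ∈ A, ∀ b ∈ B, 0 ≤ ⟪b, a⟫_ℝ := by
    intro a ha b hb
    have := gen (fun i => (eA i : Euc d)) (eA.symm ⟨a, ha⟩)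
    rw [hB] at this
    simpa using this b hb
  ext x
  constructor
  · intro hx
    rw [hD]
    intro δ hδ
    have hδ' : δ ∈ {x | ∃ c : Fin A.card → ℝ, (∀ i, 0 ≤ c i) ∧ x = ∑ i, c i • (eA i : Euc d)} := by
      rw [hB]
      intro b hb
      have := gen (fun i => (eB i : Euc d)) (eB.symm ⟨b, hb⟩)
      rw [hD] at this
      have := this δ hδ
      rw [real_inner_comm]
      simpa using this
    obtain ⟨c, hc, rfl⟩ := hδ'
    rw [sum_inner]
    refine Finset.sum_nonneg fun i _ => ?_
    rw [real_inner_smul_left]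
    exact mul_nonneg (hc i) (hx _ (eA i).2)
  · rintro ⟨c, hc, rfl⟩ a ha
    rw [inner_sum]
    refine Finset.sum_nonneg fun i _ => ?_
    rw [real_inner_smul_right, real_inner_comm]
    exact mul_nonneg (hc i) (hAB a ha _ (eB i).2)

lemma sdim_lt_of_subset_hyper {C : Set (Euc d)} {v : Euc d} (hv : v ≠ 0)
    (h : ∀ x ∈ C, ⟪v, x⟫_ℝ = 0) : sdim C < d := by
  have hle : vectorSpan ℝ C ≤ (ℝ ∙ v)ᗮ := by
    rw [vectorSpan, Submodule.span_le]
    rintro _ ⟨x, hx, y, hy, rfl⟩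
    rw [SetLike.mem_coe, Submodule.mem_orthogonal_singleton_iff_inner_right]
    simp [inner_sub_right, h x hx, h y hy]
  have h1 := Submodule.finrank_mono hle
  have h2 := Submodule.finrank_add_finrank_orthogonal (ℝ ∙ v)
  rw [finrank_span_singleton hv, finrank_euclideanSpace_fin] at h2
  unfold sdim
  omega

lemma angle_split (α : ConeAngle d) {C : Set (Euc d)} (hC : IsH C) {v : Euc d} (hv : v ≠ 0) :
    α.toFun C = α.toFun (C ∩ {x | 0 ≤ ⟪v, x⟫_ℝ}) + α.toFun (C ∩ {x | 0 ≤ ⟪-v, x⟫_ℝ}) := by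
  have h1 : IsH (C ∩ {x | 0 ≤ ⟪v, x⟫_ℝ}) := isH_inter hC (isH_half v)
  have h2 : IsH (C ∩ {x | 0 ≤ ⟪-v, x⟫_ℝ}) := isH_inter hC (isH_half (-v))
  have h3 : (C ∩ {x | 0 ≤ ⟪v, x⟫_ℝ}) ∪ (C ∩ {x | 0 ≤ ⟪-v, x⟫_ℝ}) = C := by
    rw [← Set.inter_union_distrib_left]
    apply Set.inter_eq_left.2
    intro x _
    rcases le_total 0 ⟪v, x⟫_ℝ with h | h
    · exact Or.inl h
    · right; simpa [inner_neg_left] using h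
  have h4 := isH_inter h1 h2
  have h5 := α.union' _ _ (poly_of_isH h1) (poly_of_isH h2) (by rw [h3]; exact poly_of_isH hC)
    (poly_of_isH h4)
  rw [h3, α.simple' _ (poly_of_isH h4) (sdim_lt_of_subset_hyper hv ?_)] at h5
  · linarith
  · rintro x ⟨⟨_, hx1⟩, _, hx2⟩
    simp only [Set.mem_ofPred_eq, inner_neg_left] at hx1 hx2
    linarith

/-- Sign attached to a Boolean. -/
def bsg (b : Bool) : ℝ := if b then 1 else -1

/-- Closed region of an arrangement. -/
def region {n : ℕ} (ν : Fin n → Euc d) (σ : Fin n → Bool) : Set (Euc d) :=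
  {x | ∀ i, 0 ≤ bsg (σ i) * ⟪ν i, x⟫_ℝ}

lemma isH_region {n : ℕ} (ν : Fin n → Euc d) (σ : Fin n → Bool) : IsH (region ν σ) := by
  classical
  refine ⟨Finset.univ.image (fun i => bsg (σ i) • ν i), ?_⟩
  ext x
  simp [region, real_inner_smul_left]

lemma angle_regions (α : ConeAngle d) (n : ℕ) : ∀ {C : Set (Euc d)} (_ : IsH C)
    (ν : Fin n → Euc d) (_ : ∀ i, ν i ≠ 0),
    α.toFun C = ∑ σ : Fin n → Bool, α.toFun (C ∩ region ν σ) := by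
  induction n with
  | zero =>
    intro C hC ν hν
    simp [region]
  | succ n ih =>
    intro C hC ν hν
    rw [angle_split α hC (hν 0),
      ih (isH_inter hC (isH_half _)) (fun i => ν i.succ) (fun i => hν _),
      ih (isH_inter hC (isH_half _)) (fun i => ν i.succ) (fun i => hν _),
      ← (Fin.consEquiv (fun _ => Bool)).sum_comp, Fintype.sum_prod_type, Fintype.sum_bool]
    congr 1
    · refine Finset.sum_congr rfl fun σ _ => ?_
      congr 1
      ext x
      simp [region, Fin.forall_fin_succ, Fin.consEquiv, bsg, and_assoc]
    · refine Finset.sum_congr rfl fun σ _ => ?_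
      congr 1
      ext x
      simp [region, Fin.forall_fin_succ, Fin.consEquiv, bsg, and_assoc]

lemma region_zero_or (α : ConeAngle d) {n : ℕ} (ν : Fin n → Euc d) (hν : ∀ i, ν i ≠ 0)
    (σ : Fin n → Bool) :
    α.toFun (region ν σ) = 0 ∨ ∃ x, ∀ i, 0 < bsg (σ i) * ⟪ν i, x⟫_ℝ := by
  by_cases h : ∀ i, ∃ x ∈ region ν σ, 0 < bsg (σ i) * ⟪ν i, x⟫_ℝ
  · right
    choose x hx hpos using h
    refine ⟨∑ j, x j, fun i => ?_⟩
    rw [inner_sum, Finset.mul_sum]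
    exact Finset.sum_pos' (fun j _ => hx j i) ⟨i, Finset.mem_univ _, hpos i⟩
  · left
    push Not at h
    obtain ⟨i, hi⟩ := h
    refine α.simple' _ (poly_of_isH (isH_region ν σ)) (sdim_lt_of_subset_hyper (hν i) ?_)
    intro x hx
    have h1 := hi x hx
    have h2 := hx i
    have h3 : bsg (σ i) * ⟪ν i, x⟫_ℝ = 0 := le_antisymm h1 h2
    rcases mul_eq_zero.1 h3 with h | h
    · unfold bsg at h; split_ifs at h <;> norm_num at h
    · exact h

lemma angle_generic (α : ConeAngle d) {J : Type*} (T : Finset J) (C : J → Set (Euc d))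
    (hC : ∀ j ∈ T, IsH (C j)) (a : J → ℝ) (N : Finset (Euc d)) (hN : (0 : Euc d) ∉ N)
    (h : ∀ x, (∀ v ∈ N, ⟪v, x⟫_ℝ ≠ 0) → ∑ j ∈ T, (C j).indicator (fun _ => a j) x = 0) :
    ∑ j ∈ T, a j * α.toFun (C j) = 0 := by
  classical
  have hA : ∃ A : J → Finset (Euc d), ∀ j ∈ T, C j = {x | ∀ a ∈ A j, 0 ≤ ⟪a, x⟫_ℝ} := by
    choose! A hA using hC
    exact ⟨A, hA⟩
  obtain ⟨A, hA⟩ := hA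
  let S : Finset (Euc d) := N ∪ (T.biUnion A).erase 0
  have hS0 : (0 : Euc d) ∉ S := by simp [S, hN]
  let e := S.equivFin.symm
  let ν : Fin S.card → Euc d := fun i => (e i : Euc d)
  have hν : ∀ i, ν i ≠ 0 := fun i h0 => hS0 (h0 ▸ (e i).2)
  have hνS : ∀ v ∈ S, ∃ i, ν i = v := fun v hv => ⟨e.symm ⟨v, hv⟩, by simp [ν]⟩
  have key : ∀ σ : Fin S.card → Bool, ∀ x, (∀ i, 0 < bsg (σ i) * ⟪ν i, x⟫_ℝ) → ∀ j ∈ T,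
      α.toFun (C j ∩ region ν σ) = (C j).indicator (fun _ => α.toFun (region ν σ)) x := by
    intro σ x hx j hj
    by_cases hxj : x ∈ C j
    · rw [Set.indicator_of_mem hxj]
      congr 1
      apply Set.inter_eq_right.2
      intro y hy
      rw [hA j hj] at hxj ⊢
      intro b hb
      by_cases hb0 : b = 0
      · simp [hb0]
      · obtain ⟨i, hi⟩ := hνS b (Finset.mem_union_right _ (Finset.mem_erase.2
          ⟨hb0, Finset.mem_biUnion.2 ⟨j, hj, hb⟩⟩))
        have h1 := hx i
        have h2 := hy i
        have h3 := hxj b hb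
        rw [hi] at h1 h2
        unfold bsg at h1 h2
        split_ifs at h1 h2 <;> linarith
    · rw [Set.indicator_of_notMem hxj]
      rw [hA j hj] at hxj
      simp only [Set.mem_ofPred_eq, not_forall, not_le] at hxj
      obtain ⟨b, hb, hbx⟩ := hxj
      have hb0 : b ≠ 0 := by rintro rfl; simp at hbx
      obtain ⟨i, hi⟩ := hνS b (Finset.mem_union_right _ (Finset.mem_erase.2
          ⟨hb0, Finset.mem_biUnion.2 ⟨j, hj, hb⟩⟩))
      refine α.simple' _ (poly_of_isH (isH_inter ⟨A j, hA j hj⟩ (isH_region ν σ)))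
        (sdim_lt_of_subset_hyper hb0 ?_)
      rintro y ⟨hyC, hy⟩
      rw [hA j hj] at hyC
      have h1 := hx i
      have h2 := hy i
      have h3 := hyC b hb
      rw [hi] at h1 h2
      unfold bsg at h1 h2
      split_ifs at h1 h2 <;> linarith
  have hsum : ∑ j ∈ T, a j * α.toFun (C j) =
      ∑ σ : Fin S.card → Bool, ∑ j ∈ T, a j * α.toFun (C j ∩ region ν σ) := by
    rw [Finset.sum_comm]
    refine Finset.sum_congr rfl fun j hj => ?_
    rw [angle_regions α _ (⟨A j, hA j hj⟩ : IsH (C j)) ν hν, Finset.mul_sum]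
  rw [hsum]
  refine Finset.sum_eq_zero fun σ _ => ?_
  by_cases hx : ∃ x, ∀ i, 0 < bsg (σ i) * ⟪ν i, x⟫_ℝ
  · obtain ⟨x, hx⟩ := hx
    have h1 := h x (fun v hv h0 => by
      obtain ⟨i, hi⟩ := hνS v (Finset.mem_union_left _ hv)
      have := hx i
      rw [hi, h0] at this
      simp at this)
    calc _ = ∑ j ∈ T, (C j).indicator (fun _ => a j) x * α.toFun (region ν σ) := by
          refine Finset.sum_congr rfl fun j hj => ?_
          rw [key σ x hx j hj]
          by_cases hxj : x ∈ C j <;> simp [hxj]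
      _ = 0 := by rw [← Finset.sum_mul, h1, zero_mul]
  · refine Finset.sum_eq_zero fun j hj => ?_
    -- the region is contained in a hyperplane
    have hreg : ∃ i, ∀ y ∈ region ν σ, ⟪ν i, y⟫_ℝ = 0 := by
      by_contra hcon
      push Not at hcon
      choose y hy hpos using hcon
      apply hx
      refine ⟨∑ j, y j, fun i => ?_⟩
      rw [inner_sum, Finset.mul_sum]
      refine Finset.sum_pos' (fun j _ => hy j i) ⟨i, Finset.mem_univ _, ?_⟩
      refine lt_of_le_of_ne (hy i i) (Ne.symm (mul_ne_zero ?_ (hpos i)))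
      unfold bsg; split_ifs <;> norm_num
    obtain ⟨i, hi⟩ := hreg
    rw [α.simple' _ (poly_of_isH (isH_inter ⟨A j, hA j hj⟩ (isH_region ν σ)))
        (sdim_lt_of_subset_hyper (hν i) (fun y hy => hi y hy.2)), mul_zero]

/-- Relatively open convex subsets of a subspace. -/
structure RelOpen (K : Submodule ℝ (Euc d)) (U : Set (Euc d)) : Prop where
  sub : ∀ x ∈ U, x ∈ K
  conv : Convex ℝ U
  op : ∀ x ∈ U, ∀ v ∈ K, ∃ ε : ℝ, 0 < ε ∧ x + ε • v ∈ U

lemma RelOpen.op_small {K : Submodule ℝ (Euc d)} {U : Set (Euc d)} (h : RelOpen K U)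
    {x v : Euc d} (hx : x ∈ U) (hv : v ∈ K) (δ : ℝ) (hδ : 0 < δ) :
    ∃ ε : ℝ, 0 < ε ∧ ε ≤ δ ∧ x + ε • v ∈ U := by
  obtain ⟨ε, hε, hmem⟩ := h.op x hx v hv
  refine ⟨min ε δ, lt_min hε hδ, min_le_right _ _, ?_⟩
  have h1 : min ε δ / ε ≤ 1 := (div_le_one hε).2 (min_le_left _ _)
  have h0 : 0 ≤ min ε δ / ε := (div_pos (lt_min hε hδ) hε).le
  have := h.conv.add_smul_sub_mem hx hmem ⟨h0, h1⟩
  rw [add_sub_cancel_left, smul_smul, div_mul_cancel₀ _ hε.ne'] at this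
  exact this

lemma small_pos (a b : ℝ) (ha : 0 < a) : ∃ δ : ℝ, 0 < δ ∧ ∀ ε, 0 < ε → ε ≤ δ → 0 < a + ε * b := by
  refine ⟨a / (|b| + 1), by positivity, fun ε hε hle => ?_⟩
  rw [le_div_iff₀ (by positivity)] at hle
  have := neg_abs_le b
  nlinarith

lemma RelOpen.pos {K : Submodule ℝ (Euc d)} {U : Set (Euc d)} (h : RelOpen K U)
    (f : Euc d →ₗ[ℝ] ℝ) : RelOpen K {x | x ∈ U ∧ 0 < f x} where
  sub x hx := h.sub x hx.1
  conv := by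
    have : {x | x ∈ U ∧ 0 < f x} = U ∩ {x | 0 < f x} := rfl
    rw [this]
    exact h.conv.inter (convex_halfSpace_gt f.isLinear 0)
  op := by
    rintro x ⟨hx, hfx⟩ v hv
    obtain ⟨δ, hδ, hδ'⟩ := small_pos (f x) (f v) hfx
    obtain ⟨ε, hε, hle, hmem⟩ := h.op_small hx hv δ hδ
    refine ⟨ε, hε, hmem, ?_⟩
    simpa using hδ' ε hε hle

lemma RelOpen.zero {K : Submodule ℝ (Euc d)} {U : Set (Euc d)} (h : RelOpen K U)
    (f : Euc d →ₗ[ℝ] ℝ) : RelOpen (K ⊓ LinearMap.ker f) {x | x ∈ U ∧ f x = 0} where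
  sub x hx := ⟨h.sub x hx.1, hx.2⟩
  conv := by
    have : {x | x ∈ U ∧ f x = 0} = U ∩ {x | f x = 0} := rfl
    rw [this]
    exact h.conv.inter (convex_hyperplane f.isLinear 0)
  op := by
    rintro x ⟨hx, hfx⟩ v ⟨hv, hfv⟩
    obtain ⟨ε, hε, hmem⟩ := h.op x hx v hv
    refine ⟨ε, hε, hmem, ?_⟩
    have : f v = 0 := hfv
    simp [hfx, this]

lemma finrank_inf_ker (K : Submodule ℝ (Euc d)) (f : Euc d →ₗ[ℝ] ℝ) {v : Euc d} (hv : v ∈ K)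
    (hfv : f v ≠ 0) : Module.finrank ℝ K =
      Module.finrank ℝ (K ⊓ LinearMap.ker f : Submodule ℝ (Euc d)) + 1 := by
  have h1 := LinearMap.finrank_range_add_finrank_ker (f.domRestrict K)
  have hr : LinearMap.range (f.domRestrict K) = ⊤ := by
    rw [LinearMap.range_eq_top]
    intro y
    exact ⟨(y / f v) • ⟨v, hv⟩, by simp [hfv]⟩
  have hk : Module.finrank ℝ (LinearMap.ker (f.domRestrict K)) =
      Module.finrank ℝ (K ⊓ LinearMap.ker f : Submodule ℝ (Euc d)) := by
    have e : LinearMap.ker (f.domRestrict K) = (K ⊓ LinearMap.ker f).comap K.subtype := by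
      ext x; simp
    rw [e]
    exact (Submodule.comapSubtypeEquivOfLe inf_le_left).finrank_eq
  rw [hr, finrank_top, Module.finrank_self, hk] at h1
  omega

/-- Subspace cut out by the vanishing functionals. -/
def cellSpace {n : ℕ} (f : Fin n → Euc d →ₗ[ℝ] ℝ) (K : Submodule ℝ (Euc d))
    (σ : Fin n → SignType) : Submodule ℝ (Euc d) :=
  K ⊓ ⨅ i, ⨅ (_ : σ i = 0), LinearMap.ker (f i)

lemma mem_cellSpace {n : ℕ} (f : Fin n → Euc d →ₗ[ℝ] ℝ) (K : Submodule ℝ (Euc d))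
    (σ : Fin n → SignType) (x : Euc d) :
    x ∈ cellSpace f K σ ↔ x ∈ K ∧ ∀ i, σ i = 0 → f i x = 0 := by
  simp [cellSpace, Submodule.mem_iInf]

open Classical in
/-- Euler relation for the cells of an arrangement in a relatively open convex set. -/
lemma euler (n : ℕ) : ∀ (f : Fin n → Euc d →ₗ[ℝ] ℝ) (K : Submodule ℝ (Euc d)) (U : Set (Euc d))
    (_ : RelOpen K U),
    ∑ σ : Fin n → SignType, (if ∃ x ∈ U, ∀ i, SignType.sign (f i x) = σ i then
      (-1 : ℝ) ^ Module.finrank ℝ (cellSpace f K σ) else 0) =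
    if U.Nonempty then (-1 : ℝ) ^ Module.finrank ℝ K else 0 := by
  induction n with
  | zero =>
    intro f K U hU
    have : ∀ σ, cellSpace f K σ = K := by intro σ; simp [cellSpace]
    rw [Fintype.sum_unique, this]
    refine if_congr ?_ rfl rfl
    simp [Set.Nonempty]
  | succ n ih =>
    intro f K U hU
    rw [← (Fin.consEquiv (fun _ => SignType)).sum_comp, Fintype.sum_prod_type]
    have huniv : (Finset.univ : Finset SignType) = {0, -1, 1} := rfl
    have step : ∀ (τ : SignType) (K' : Submodule ℝ (Euc d)) (U' : Set (Euc d)), RelOpen K' U' →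
        (∀ x, x ∈ U' ↔ x ∈ U ∧ SignType.sign (f 0 x) = τ) →
        (∀ x, x ∈ K' ↔ x ∈ K ∧ (τ = 0 → f 0 x = 0)) →
        ∑ σ : Fin n → SignType, (if ∃ x ∈ U, ∀ i, SignType.sign (f i x) =
          (Fin.consEquiv (fun _ => SignType)) (τ, σ) i then
          (-1 : ℝ) ^ Module.finrank ℝ (cellSpace f K ((Fin.consEquiv (fun _ => SignType)) (τ, σ)))
          else 0) =
        if U'.Nonempty then (-1 : ℝ) ^ Module.finrank ℝ K' else 0 := by
      intro τ K' U' hRO hU' hK'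
      rw [← ih (fun i => f i.succ) K' U' hRO]
      refine Finset.sum_congr rfl fun σ _ => ?_
      have h1 : cellSpace f K ((Fin.consEquiv (fun _ => SignType)) (τ, σ)) =
          cellSpace (fun i => f i.succ) K' σ := by
        ext x
        simp [mem_cellSpace, hK', Fin.forall_fin_succ, Fin.consEquiv, and_assoc]
      have h2 : (∃ x ∈ U, ∀ i, SignType.sign (f i x) =
          (Fin.consEquiv (fun _ => SignType)) (τ, σ) i) ↔
          ∃ x ∈ U', ∀ i : Fin n, SignType.sign (f i.succ x) = σ i := by
        simp [hU', Fin.forall_fin_succ, Fin.consEquiv, and_assoc]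
      rw [h1]
      simp only [h2]
    rw [huniv, Finset.sum_insert (by decide), Finset.sum_insert (by decide), Finset.sum_singleton,
      step 0 _ _ (hU.zero (f 0)) (fun x => by simp) (fun x => by simp),
      step 1 _ _ (hU.pos (f 0)) (fun x => by simp [sign_eq_one_iff]) (fun x => by simp),
      step (-1) _ _ (hU.pos (-f 0)) (fun x => by simp [sign_eq_neg_one_iff]) (fun x => by simp)]
    by_cases hne : U.Nonempty
    swap
    · have : ∀ p : Euc d → Prop, ¬ {x | x ∈ U ∧ p x}.Nonempty := by
        rintro p ⟨x, hx, _⟩; exact hne ⟨x, hx⟩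
      simp only [this, hne, if_false, add_zero]
    rw [if_pos hne]
    by_cases hK : ∀ v ∈ K, f 0 v = 0
    · have h0 : K ⊓ LinearMap.ker (f 0) = K := inf_eq_left.2 hK
      have hz : {x | x ∈ U ∧ f 0 x = 0}.Nonempty := by
        obtain ⟨x, hx⟩ := hne
        exact ⟨x, hx, hK x (hU.sub x hx)⟩
      have hp : ¬ {x | x ∈ U ∧ 0 < f 0 x}.Nonempty := by
        rintro ⟨x, hx, h⟩
        rw [hK x (hU.sub x hx)] at h
        exact lt_irrefl _ h
      have hm : ¬ {x | x ∈ U ∧ 0 < (-f 0) x}.Nonempty := by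
        rintro ⟨x, hx, h⟩
        rw [LinearMap.neg_apply, hK x (hU.sub x hx), neg_zero] at h
        exact lt_irrefl _ h
      rw [if_pos hz, if_neg hp, if_neg hm, h0]
      ring
    · push Not at hK
      obtain ⟨v, hv, hfv⟩ := hK
      have hfr := finrank_inf_ker K (f 0) hv hfv
      have hpm : ∀ x ∈ U, f 0 x = 0 → {x | x ∈ U ∧ 0 < f 0 x}.Nonempty ∧
          {x | x ∈ U ∧ 0 < (-f 0) x}.Nonempty := by
        intro x hx hfx
        have hw : ∃ w ∈ K, 0 < f 0 w := by
          rcases lt_or_gt_of_ne hfv with h | h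
          · exact ⟨-v, K.neg_mem hv, by simpa using h⟩
          · exact ⟨v, hv, h⟩
        obtain ⟨w, hw, hfw⟩ := hw
        obtain ⟨ε, hε, h1⟩ := hU.op x hx w hw
        obtain ⟨ε', hε', h2⟩ := hU.op x hx (-w) (K.neg_mem hw)
        refine ⟨⟨_, h1, ?_⟩, ⟨_, h2, ?_⟩⟩
        · simp only [map_add, map_smul, hfx, smul_eq_mul, zero_add]; positivity
        · simp only [LinearMap.neg_apply, map_add, map_smul, map_neg, hfx, smul_eq_mul, zero_add,
            mul_neg, neg_neg]; positivity
      have hz : {x | x ∈ U ∧ 0 < f 0 x}.Nonempty → {x | x ∈ U ∧ 0 < (-f 0) x}.Nonempty →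
          {x | x ∈ U ∧ f 0 x = 0}.Nonempty := by
        rintro ⟨x, hx, hfx⟩ ⟨y, hy, hfy⟩
        rw [LinearMap.neg_apply] at hfy
        have hpos : 0 < f 0 x - f 0 y := by linarith
        refine ⟨(-f 0 y / (f 0 x - f 0 y)) • x + (f 0 x / (f 0 x - f 0 y)) • y,
          hU.conv hx hy (by positivity) (by positivity) ?_, ?_⟩
        · field_simp; ring
        · simp only [map_add, map_smul, smul_eq_mul]; field_simp; ring
      rw [hfr, pow_succ]
      by_cases h0 : {x | x ∈ U ∧ f 0 x = 0}.Nonempty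
      · obtain ⟨x, hx, hfx⟩ := h0
        obtain ⟨h1, h2⟩ := hpm x hx hfx
        rw [if_pos ⟨x, hx, hfx⟩, if_pos h1, if_pos h2]
        ring
      · rw [if_neg h0]
        by_cases h1 : {x | x ∈ U ∧ 0 < f 0 x}.Nonempty
        · rw [if_pos h1, if_neg (fun h2 => h0 (hz h1 h2))]; ring
        · rw [if_neg h1, if_pos]
          · ring
          · obtain ⟨x, hx⟩ := hne
            refine ⟨x, hx, ?_⟩
            rw [LinearMap.neg_apply]
            rcases lt_trichotomy (f 0 x) 0 with h | h | h
            · linarith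
            · exact absurd ⟨x, hx, h⟩ h0
            · exact absurd ⟨x, hx, h⟩ h1

lemma IsPolytope.isCompact {G : Set (Euc d)} (hG : IsPolytope G) : IsCompact G := by
  obtain ⟨s, _, rfl⟩ := hG
  exact s.finite_toSet.isCompact_convexHull ℝ

lemma IsPolytope.convex {G : Set (Euc d)} (hG : IsPolytope G) : Convex ℝ G := by
  obtain ⟨s, _, rfl⟩ := hG
  exact convex_convexHull ℝ _

lemma IsPolytope.nonempty {G : Set (Euc d)} (hG : IsPolytope G) : G.Nonempty := by
  obtain ⟨s, hs, rfl⟩ := hG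
  exact hs.to_set.convexHull

lemma maxFace_nonempty {G : Set (Euc d)} (hG : IsPolytope G) (c : Euc d) :
    (maxFace G c).Nonempty := by
  obtain ⟨x, hx, hmax⟩ := hG.isCompact.exists_isMaxOn hG.nonempty
    (f := fun x => ⟪c, x⟫_ℝ) (by fun_prop)
  exact ⟨x, hx, fun y hy => hmax hy⟩

lemma isExposed_maxFace (G : Set (Euc d)) (c : Euc d) : IsExposed ℝ G (maxFace G c) :=
  fun _ => ⟨innerSL ℝ c, rfl⟩

lemma face_eq_maxFace {P F : Set (Euc d)} (h : IsFace P F) (hne : F.Nonempty) :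
    ∃ c, F = maxFace P c := by
  obtain ⟨l, hl⟩ := h hne
  refine ⟨(InnerProductSpace.toDual ℝ (Euc d)).symm l, ?_⟩
  rw [hl]
  ext x
  simp [maxFace]

lemma maxFace_subset (G : Set (Euc d)) (c : Euc d) : maxFace G c ⊆ G := fun _ hx => hx.1

lemma maxFace_zero (G : Set (Euc d)) : maxFace G 0 = G := by
  ext x; simp [maxFace]

lemma maxFace_inner_eq {G : Set (Euc d)} {c x y : Euc d} (hx : x ∈ maxFace G c)
    (hy : y ∈ maxFace G c) : ⟪c, x⟫_ℝ = ⟪c, y⟫_ℝ :=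
  le_antisymm (hy.2 x hx.1) (hx.2 y hy.1)

lemma isPolytope_maxFace {G : Set (Euc d)} (hG : IsPolytope G) (c : Euc d) :
    ∀ s : Finset (Euc d), G = convexHull ℝ (s : Set (Euc d)) →
    ∃ t : Finset (Euc d), t ⊆ s ∧ t.Nonempty ∧
      maxFace G c = convexHull ℝ (t : Set (Euc d)) := by
  classical
  intro s hs
  have hexp := isExposed_maxFace G c
  have hcomp : IsCompact (maxFace G c) := hexp.isCompact hG.isCompact
  have hconv : Convex ℝ (maxFace G c) := hexp.convex hG.convex
  have hsub : (maxFace G c).extremePoints ℝ ⊆ (s : Set (Euc d)) := by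
    refine (hexp.isExtreme.extremePoints_subset_extremePoints).trans ?_
    rw [hs]
    exact extremePoints_convexHull_subset
  have hfin : ((maxFace G c).extremePoints ℝ).Finite := s.finite_toSet.subset hsub
  have hkm := closure_convexHull_extremePoints hcomp hconv
  have hcl : closure (convexHull ℝ ((maxFace G c).extremePoints ℝ)) =
      convexHull ℝ ((maxFace G c).extremePoints ℝ) :=
    (hfin.isCompact_convexHull ℝ).isClosed.closure_eq
  refine ⟨hfin.toFinset, ?_, ?_, ?_⟩
  · intro x hx
    exact hsub (by simpa using hx)
  · have := hcomp.extremePoints_nonempty (maxFace_nonempty hG c)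
    simpa using this
  · rw [Set.Finite.coe_toFinset, ← hcl, hkm]

lemma IsPolytope.maxFace {G : Set (Euc d)} (hG : IsPolytope G) (c : Euc d) :
    IsPolytope (maxFace G c) := by
  obtain ⟨s, hs, h⟩ := hG
  obtain ⟨t, _, ht, h'⟩ := isPolytope_maxFace ⟨s, hs, h⟩ c s h
  exact ⟨t, ht, h'⟩

/-- If the maximal faces share a point, the maximal face of a positive combination is the
intersection. -/
lemma maxFace_add {G : Set (Euc d)} {c v : Euc d} {ε : ℝ} (hε : 0 < ε) {p : Euc d}
    (hc : p ∈ maxFace G c) (hv : p ∈ maxFace G v) :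
    maxFace G (c + ε • v) = maxFace G c ∩ maxFace G v := by
  ext x
  constructor
  · rintro ⟨hx, hmax⟩
    have h := hmax p hc.1
    simp only [inner_add_left, real_inner_smul_left] at h
    have h1 := hc.2 x hx
    have h2 := hv.2 x hx
    have h3 : ⟪v, p⟫_ℝ ≤ ⟪v, x⟫_ℝ := by
      by_contra hcon
      push Not at hcon
      nlinarith
    have h4 : ⟪c, p⟫_ℝ ≤ ⟪c, x⟫_ℝ := by nlinarith
    exact ⟨⟨hx, fun y hy => (hc.2 y hy).trans h4⟩, ⟨hx, fun y hy => (hv.2 y hy).trans h3⟩⟩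
  · rintro ⟨⟨hx, h1⟩, _, h2⟩
    refine ⟨hx, fun y hy => ?_⟩
    simp only [inner_add_left, real_inner_smul_left]
    nlinarith [h1 y hy, h2 y hy]

lemma finite_small {ι : Type*} (S : Finset ι) (p : ι → ℝ → Prop)
    (h : ∀ i ∈ S, ∃ δ : ℝ, 0 < δ ∧ ∀ ε, 0 < ε → ε ≤ δ → p i ε) :
    ∃ δ : ℝ, 0 < δ ∧ ∀ ε, 0 < ε → ε ≤ δ → ∀ i ∈ S, p i ε := by
  classical
  induction S using Finset.induction_on with
  | empty => exact ⟨1, one_pos, by simp⟩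
  | insert a S _ ih =>
    obtain ⟨δ1, h1, h1'⟩ := ih (fun i hi => h i (Finset.mem_insert_of_mem hi))
    obtain ⟨δ2, h2, h2'⟩ := h a (Finset.mem_insert_self _ _)
    refine ⟨min δ1 δ2, lt_min h1 h2, fun ε hε hle i hi => ?_⟩
    rcases Finset.mem_insert.1 hi with rfl | hi
    · exact h2' ε hε (hle.trans (min_le_right _ _))
    · exact h1' ε hε (hle.trans (min_le_left _ _)) i hi

lemma maxFace_pert {G : Set (Euc d)} (hG : IsPolytope G) (c v : Euc d) :
    ∃ δ : ℝ, 0 < δ ∧ ∀ ε, 0 < ε → ε ≤ δ → maxFace G (c + ε • v) = maxFace (maxFace G c) v := by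
  classical
  obtain ⟨s, hs, h⟩ := id hG
  obtain ⟨q, hq, hqv⟩ := maxFace_nonempty (hG.maxFace c) v
  obtain ⟨δ, hδ, hsm⟩ := finite_small s
    (fun x ε => x ∈ maxFace G c ∨ ⟪c + ε • v, x⟫_ℝ < ⟪c + ε • v, q⟫_ℝ) (by
      intro x hx
      have hxG : x ∈ G := h ▸ subset_convexHull ℝ _ hx
      by_cases hxF : x ∈ maxFace G c
      · exact ⟨1, one_pos, fun _ _ _ => Or.inl hxF⟩
      · have hlt : ⟪c, x⟫_ℝ < ⟪c, q⟫_ℝ := by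
          refine lt_of_not_ge fun hge => hxF ⟨hxG, fun y hy => (hq.2 y hy).trans hge⟩
        obtain ⟨δ, hδ, h'⟩ := small_pos (⟪c, q⟫_ℝ - ⟪c, x⟫_ℝ) (⟪v, q⟫_ℝ - ⟪v, x⟫_ℝ) (by linarith)
        refine ⟨δ, hδ, fun ε hε hle => Or.inr ?_⟩
        have := h' ε hε hle
        simp only [inner_add_left, real_inner_smul_left]
        linarith)
  refine ⟨δ, hδ, fun ε hε hle => ?_⟩
  have hsub : maxFace G (c + ε • v) ⊆ maxFace G c := by
    obtain ⟨t, hts, _, ht⟩ := isPolytope_maxFace hG (c + ε • v) s h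
    rw [ht]
    refine convexHull_min ?_ (hG.maxFace c).convex
    intro x hx
    rcases hsm ε hε hle x (hts hx) with h1 | h1
    · exact h1
    · have hx' : x ∈ maxFace G (c + ε • v) := ht ▸ subset_convexHull ℝ _ hx
      exact absurd (hx'.2 q hq.1) (not_le.2 h1)
  ext x
  constructor
  · intro hx
    refine ⟨hsub hx, fun y hy => ?_⟩
    have h1 := hx.2 y hy.1
    have h2 := maxFace_inner_eq (hsub hx) hy
    simp only [inner_add_left, real_inner_smul_left, h2] at h1
    nlinarith
  · rintro ⟨hx, hxm⟩
    obtain ⟨p, hp⟩ := maxFace_nonempty hG (c + ε • v)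
    refine ⟨hx.1, fun y hy => (hp.2 y hy).trans ?_⟩
    have h1 := maxFace_inner_eq (hsub hp) hx
    have h2 := hxm p (hsub hp)
    simp only [inner_add_left, real_inner_smul_left, h1]
    nlinarith

/-- The normal fan of `G` is given by the arrangement `z`. -/
def Belt {k : ℕ} (G : Set (Euc d)) (z : Fin k → Euc d) : Prop :=
  ∀ x y : Euc d, (∀ i, SignType.sign ⟪z i, x⟫_ℝ = SignType.sign ⟪z i, y⟫_ℝ) ↔
    maxFace G x = maxFace G y

lemma realSign_iff (a b : ℝ) : Real.sign a = Real.sign b ↔ SignType.sign a = SignType.sign b := by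
  rcases lt_trichotomy a 0 with ha | rfl | ha <;> rcases lt_trichotomy b 0 with hb | rfl | hb <;>
    simp [Real.sign_of_neg, Real.sign_of_pos, sign_neg, sign_pos, *] <;> norm_num

lemma sign_add_small (a b : ℝ) (ha : a ≠ 0) : ∃ δ : ℝ, 0 < δ ∧ ∀ ε, 0 < ε → ε ≤ δ →
    SignType.sign (a + ε * b) = SignType.sign a := by
  rcases lt_or_gt_of_ne ha with h | h
  · obtain ⟨δ, hδ, h'⟩ := small_pos (-a) (-b) (by linarith)
    refine ⟨δ, hδ, fun ε hε hle => ?_⟩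
    have := h' ε hε hle
    rw [sign_neg h, sign_neg (by linarith)]
  · obtain ⟨δ, hδ, h'⟩ := small_pos a b h
    refine ⟨δ, hδ, fun ε hε hle => ?_⟩
    rw [sign_pos h, sign_pos (h' ε hε hle)]

lemma sign_mul_pos' {ε : ℝ} (hε : 0 < ε) (b : ℝ) :
    SignType.sign (ε * b) = SignType.sign b := by
  rw [sign_mul, sign_pos hε, one_mul]

open Classical in
lemma sign_pert {k : ℕ} (z : Fin k → Euc d) (c v : Euc d) : ∃ δ : ℝ, 0 < δ ∧ ∀ ε, 0 < ε → ε ≤ δ →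
    ∀ i, SignType.sign ⟪z i, c + ε • v⟫_ℝ =
      if ⟪z i, c⟫_ℝ = 0 then SignType.sign ⟪z i, v⟫_ℝ else SignType.sign ⟪z i, c⟫_ℝ := by
  obtain ⟨δ, hδ, h⟩ := finite_small (Finset.univ : Finset (Fin k)) (fun i ε =>
    SignType.sign ⟪z i, c + ε • v⟫_ℝ =
      if ⟪z i, c⟫_ℝ = 0 then SignType.sign ⟪z i, v⟫_ℝ else SignType.sign ⟪z i, c⟫_ℝ) (by
    intro i _
    by_cases h0 : ⟪z i, c⟫_ℝ = 0
    · refine ⟨1, one_pos, fun ε hε _ => ?_⟩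
      rw [if_pos h0, inner_add_right, h0, zero_add, real_inner_smul_right, sign_mul_pos' hε]
    · obtain ⟨δ, hδ, h⟩ := sign_add_small _ ⟪z i, v⟫_ℝ h0
      refine ⟨δ, hδ, fun ε hε hle => ?_⟩
      rw [if_neg h0, inner_add_right, real_inner_smul_right, h ε hε hle])
  exact ⟨δ, hδ, fun ε hε hle i => h ε hε hle i (Finset.mem_univ _)⟩

open Classical in
/-- The arrangement of a face. -/
def locz {k : ℕ} (z : Fin k → Euc d) (c : Euc d) (i : Fin k) : Euc d :=
  if ⟪z i, c⟫_ℝ = 0 then z i else 0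

lemma Belt.face {k : ℕ} {G : Set (Euc d)} {z : Fin k → Euc d} (hG : IsPolytope G) (h : Belt G z)
    (c : Euc d) : Belt (maxFace G c) (locz z c) := by
  intro x y
  obtain ⟨δ1, h1, h1'⟩ := maxFace_pert hG c x
  obtain ⟨δ2, h2, h2'⟩ := maxFace_pert hG c y
  obtain ⟨δ3, h3, h3'⟩ := sign_pert z c x
  obtain ⟨δ4, h4, h4'⟩ := sign_pert z c y
  obtain ⟨ε, hε, e1, e2, e3, e4⟩ : ∃ ε : ℝ, 0 < ε ∧ ε ≤ δ1 ∧ ε ≤ δ2 ∧ ε ≤ δ3 ∧ ε ≤ δ4 := by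
    refine ⟨min (min δ1 δ2) (min δ3 δ4), by positivity, ?_, ?_, ?_, ?_⟩ <;> simp
  rw [← h1' ε hε e1, ← h2' ε hε e2, ← h]
  refine forall_congr' fun i => ?_
  rw [h3' ε hε e3, h4' ε hε e4]
  unfold locz
  split_ifs <;> simp

lemma face_face {G : Set (Euc d)} (hG : IsPolytope G) (c x : Euc d) :
    ∃ y, maxFace (maxFace G c) x = maxFace G y := by
  obtain ⟨δ1, h1, h1'⟩ := maxFace_pert hG c x
  exact ⟨_, (h1' δ1 h1 le_rfl).symm⟩

lemma maxFace_of_subset {G : Set (Euc d)} (hG : IsPolytope G) {c G' : _} (h : maxFace G c ⊆ G')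
    (hG' : G' ⊆ G) : maxFace G c = maxFace G' c := by
  ext x
  constructor
  · intro hx
    exact ⟨h hx, fun y hy => hx.2 y (hG' hy)⟩
  · intro hx
    obtain ⟨p, hp⟩ := maxFace_nonempty hG c
    exact ⟨hG' hx.1, fun y hy => (hp.2 y hy).trans (hx.2 p (h hp))⟩

/-- Orthogonality to the linear space of a set. -/
lemma mem_vectorSpan_orth {F : Set (Euc d)} {v : Euc d} :
    v ∈ (vectorSpan ℝ F)ᗮ ↔ ∀ x ∈ F, ∀ y ∈ F, ⟪v, x⟫_ℝ = ⟪v, y⟫_ℝ := by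
  rw [Submodule.mem_orthogonal']
  constructor
  · intro h x hx y hy
    have := h _ (vsub_mem_vectorSpan ℝ hx hy)
    rw [vsub_eq_sub, inner_sub_right] at this
    linarith
  · intro h u hu
    rw [vectorSpan] at hu
    induction hu using Submodule.span_induction with
    | mem w hw =>
      obtain ⟨x, hx, y, hy, rfl⟩ := hw
      simp only [vsub_eq_sub, inner_sub_right, h x hx y hy, sub_self]
    | zero => simp
    | add a b _ _ ha hb => rw [inner_add_right, ha, hb, add_zero]
    | smul c a _ ha => rw [real_inner_smul_right, ha, mul_zero]

lemma mem_span_orth {S : Set (Euc d)} {v : Euc d} :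
    v ∈ (Submodule.span ℝ S)ᗮ ↔ ∀ x ∈ S, ⟪x, v⟫_ℝ = 0 := by
  rw [Submodule.mem_orthogonal]
  constructor
  · intro h x hx
    exact h x (Submodule.subset_span hx)
  · intro h u hu
    induction hu using Submodule.span_induction with
    | mem w hw => exact h w hw
    | zero => simp
    | add a b _ _ ha hb => rw [inner_add_left, ha, hb, add_zero]
    | smul c a _ ha => rw [real_inner_smul_left, ha, mul_zero]

lemma Belt.vectorSpan_maxFace {k : ℕ} {G : Set (Euc d)} {z : Fin k → Euc d} (hG : IsPolytope G)
    (h : Belt G z) (c : Euc d) :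
    vectorSpan ℝ (maxFace G c) = Submodule.span ℝ {w | ∃ i, w = z i ∧ ⟪z i, c⟫_ℝ = 0} := by
  have : (vectorSpan ℝ (maxFace G c))ᗮ =
      (Submodule.span ℝ {w | ∃ i, w = z i ∧ ⟪z i, c⟫_ℝ = 0})ᗮ := by
    ext v
    rw [mem_vectorSpan_orth, mem_span_orth]
    obtain ⟨δ1, h1, h1'⟩ := maxFace_pert hG c v
    obtain ⟨δ2, h2, h2'⟩ := sign_pert z c v
    obtain ⟨ε, hε, e1, e2⟩ : ∃ ε : ℝ, 0 < ε ∧ ε ≤ δ1 ∧ ε ≤ δ2 :=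
      ⟨min δ1 δ2, by positivity, by simp, by simp⟩
    constructor
    · rintro hv _ ⟨i, rfl, hi⟩
      have hF : maxFace (maxFace G c) v = maxFace G c := by
        ext x
        exact ⟨fun hx => hx.1, fun hx => ⟨hx, fun y hy => (hv y hy x hx).le⟩⟩
      have := (h (c + ε • v) c).2 (by rw [h1' ε hε e1, hF]) i
      rw [h2' ε hε e2 i, if_pos hi, hi, sign_zero, sign_eq_zero_iff] at this
      exact this
    · intro hv
      have hs := (h (c + ε • v) c).1 (fun i => by
        rw [h2' ε hε e2 i]
        split_ifs with hi
        · rw [hv _ ⟨i, rfl, hi⟩, hi]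
        · rfl)
      rw [h1' ε hε e1] at hs
      intro x hx y hy
      rw [← hs] at hx hy
      exact maxFace_inner_eq hx hy
  have h2 := congrArg Submodule.orthogonal this
  rwa [Submodule.orthogonal_orthogonal, Submodule.orthogonal_orthogonal] at h2

lemma Belt.subset_iff {k : ℕ} {G : Set (Euc d)} {z : Fin k → Euc d} (hG : IsPolytope G)
    (h : Belt G z) (x c : Euc d) :
    maxFace G x ⊆ maxFace G c ↔
      ∀ i, ⟪z i, c⟫_ℝ ≠ 0 → SignType.sign ⟪z i, x⟫_ℝ = SignType.sign ⟪z i, c⟫_ℝ := by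
  obtain ⟨δ1, h1, h1'⟩ := maxFace_pert hG c x
  obtain ⟨δ2, h2, h2'⟩ := sign_pert z c x
  obtain ⟨ε, hε, e1, e2⟩ : ∃ ε : ℝ, 0 < ε ∧ ε ≤ δ1 ∧ ε ≤ δ2 :=
    ⟨min δ1 δ2, by positivity, by simp, by simp⟩
  constructor
  · intro hsub i hi
    obtain ⟨p, hp⟩ := maxFace_nonempty hG x
    have := maxFace_add hε (hsub hp) hp
    rw [Set.inter_eq_right.2 hsub] at this
    rw [← (h _ _).2 this i, h2' ε hε e2 i, if_neg hi]
  · intro hs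
    have : maxFace G (c + ε • x) = maxFace G x := (h _ _).1 (fun i => by
      rw [h2' ε hε e2 i]
      split_ifs with hi
      · rfl
      · exact (hs i hi).symm)
    rw [← this, h1' ε hε e1]
    exact maxFace_subset _ _

lemma mem_normalCone_iff {G F : Set (Euc d)} {c : Euc d} (hF : F ⊆ G) :
    c ∈ normalCone F G ↔ F ⊆ maxFace G c :=
  ⟨fun h x hx => ⟨hF hx, fun y hy => h x hx y hy⟩, fun h x hx y hy => (h hx).2 y hy⟩

lemma outerCone_eq {k : ℕ} {G : Set (Euc d)} {z : Fin k → Euc d} (hG : IsPolytope G)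
    (h : Belt G z) (x0 : Euc d) :
    outerCone (maxFace G x0) G = {y | ∀ i, 0 ≤ ((SignType.sign ⟪z i, x0⟫_ℝ : SignType) : ℝ) *
      ⟪(vectorSpan ℝ (maxFace G x0))ᗮ.starProjection (z i), y⟫_ℝ} := by
  set M := vectorSpan ℝ (maxFace G x0) with hM
  have hMs := h.vectorSpan_maxFace hG x0
  rw [← hM] at hMs
  have hzM : ∀ i, ⟪z i, x0⟫_ℝ = 0 → z i ∈ M := fun i hi => by
    rw [hMs]; exact Submodule.subset_span ⟨i, rfl, hi⟩
  ext y
  constructor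
  · rintro ⟨n, hn, l, hl, rfl⟩ i
    rw [mem_normalCone_iff (maxFace_subset _ _)] at hn
    have hnM : n ∈ Mᗮ := mem_vectorSpan_orth.2 fun a ha b hb => maxFace_inner_eq (hn ha) (hn hb)
    have hs := (h.subset_iff hG x0 n).1 hn i
    have hlM : l ∈ Mᗮᗮ := by rw [Submodule.orthogonal_orthogonal]; exact hl
    dsimp only
    rw [inner_add_right, Submodule.inner_starProjection_left_eq_right,
      Submodule.starProjection_eq_self_iff.2 hnM,
      Submodule.inner_starProjection_left_eq_right,
      (Submodule.starProjection_apply_eq_zero_iff _).2 hlM, inner_zero_right, add_zero]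
    by_cases h0 : ⟪z i, n⟫_ℝ = 0
    · simp [h0]
    · rw [hs h0, sign_mul_self]
      exact abs_nonneg _
  · intro hy
    refine ⟨Mᗮ.starProjection y, ?_, y - Mᗮ.starProjection y, ?_, by simp⟩
    · rw [mem_normalCone_iff (maxFace_subset _ _), h.subset_iff hG]
      intro i hi
      have h1 := hy i
      rw [Submodule.inner_starProjection_left_eq_right] at h1
      have h2 : ⟪z i, x0⟫_ℝ ≠ 0 := by
        intro h0
        exact hi ((Submodule.mem_orthogonal _ _).1 (Submodule.starProjection_apply_mem _ _) _
          (hzM i h0))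
      rcases lt_or_gt_of_ne hi with h3 | h3 <;> rcases lt_or_gt_of_ne h2 with h4 | h4
      · rw [sign_neg h3, sign_neg h4]
      · rw [sign_pos h4] at h1
        simp only [SignType.coe_one, one_mul] at h1
        linarith
      · rw [sign_neg h4] at h1
        simp only [SignType.coe_neg_one, neg_mul, one_mul] at h1
        linarith
      · rw [sign_pos h3, sign_pos h4]
    · have := Submodule.sub_starProjection_mem_orthogonal (K := Mᗮ) y
      rwa [Submodule.orthogonal_orthogonal] at this

lemma isH_outerCone {k : ℕ} {G : Set (Euc d)} {z : Fin k → Euc d} (hG : IsPolytope G)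
    (h : Belt G z) (x0 : Euc d) : IsH (outerCone (maxFace G x0) G) := by
  classical
  rw [outerCone_eq hG h]
  refine ⟨Finset.univ.image (fun i => ((SignType.sign ⟪z i, x0⟫_ℝ : SignType) : ℝ) •
    (vectorSpan ℝ (maxFace G x0))ᗮ.starProjection (z i)), ?_⟩
  ext x
  simp [real_inner_smul_left]

lemma relPt_mem {F : Set (Euc d)} (hc : Convex ℝ F) (hne : F.Nonempty) :
    relPt F ∈ intrinsicInterior ℝ F := by
  have h := Set.Nonempty.intrinsicInterior hc hne
  rw [relPt, dif_pos h]
  exact h.some_mem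

lemma relint_extend {F : Set (Euc d)} {q x : Euc d} (hq : q ∈ intrinsicInterior ℝ F) (hx : x ∈ F) :
    ∃ ε : ℝ, 0 < ε ∧ q + ε • (q - x) ∈ F := by
  obtain ⟨y, hy, rfl⟩ := mem_intrinsicInterior.1 hq
  let g : ℝ → affineSpan ℝ F := fun t =>
    ⟨AffineMap.lineMap (y : Euc d) x t, AffineMap.lineMap_mem _ y.2 (mem_affineSpan ℝ hx)⟩
  have hg : Continuous g := by
    apply Continuous.subtype_mk
    exact AffineMap.lineMap_continuous
  have hopen := isOpen_interior.preimage hg (t := interior ((↑) ⁻¹' F : Set (affineSpan ℝ F)))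
  have h0 : (0 : ℝ) ∈ g ⁻¹' interior ((↑) ⁻¹' F : Set (affineSpan ℝ F)) := by
    have : g 0 = y := by ext; simp [g]
    rw [Set.mem_preimage, this]; exact hy
  obtain ⟨δ, hδ, hball⟩ := Metric.isOpen_iff.1 hopen 0 h0
  have hmem := hball (show (-(δ / 2) : ℝ) ∈ Metric.ball 0 δ by
    rw [Metric.mem_ball, dist_zero_right, norm_neg, Real.norm_eq_abs, abs_of_pos (by positivity)]
    linarith)
  have hF : (AffineMap.lineMap (y : Euc d) x (-(δ / 2)) : Euc d) ∈ F := interior_subset (s := ((↑) ⁻¹' F : Set (affineSpan ℝ F))) hmem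
  refine ⟨δ / 2, by positivity, ?_⟩
  convert hF using 1
  rw [AffineMap.lineMap_apply_module']
  module

/-- The inner cone is given by inequalities. -/
lemma isH_innerCone {G : Set (Euc d)} (hG : IsPolytope G) (F : Set (Euc d)) :
    IsH (innerCone F G) := by
  classical
  set q := relPt F with hq
  obtain ⟨s, hs, hGs⟩ := id hG
  let e := s.equivFin.symm
  have hH := isH_add_cone (isH_orth (vectorSpan ℝ G)) s.card (fun i => (e i : Euc d) - q)
  have hadd : ∀ a ∈ innerCone F G, ∀ b ∈ innerCone F G, a + b ∈ innerCone F G := by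
    rintro _ ⟨_, ⟨c, _, ⟨x, hx, rfl⟩, hc, rfl⟩, l, hl, rfl⟩
      _ ⟨_, ⟨c', _, ⟨x', hx', rfl⟩, hc', rfl⟩, l', hl', rfl⟩
    dsimp only
    by_cases h0 : c + c' = 0
    · have h1 : c = 0 := by linarith
      have h2 : c' = 0 := by linarith
      refine ⟨0, ⟨0, _, ⟨x, hx, rfl⟩, le_rfl, by simp⟩, l + l', Submodule.add_mem _ hl hl', ?_⟩
      simp [h1, h2]
    · have hpos : 0 < c + c' := lt_of_le_of_ne (by positivity) (Ne.symm h0)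
      refine ⟨_, ⟨c + c', _, ⟨(c / (c + c')) • x + (c' / (c + c')) • x', ?_, rfl⟩, hpos.le, rfl⟩,
        l + l', Submodule.add_mem _ hl hl', ?_⟩
      · exact hG.convex hx hx' (by positivity) (by positivity) (by field_simp)
      · dsimp only
        rw [smul_sub, smul_add, smul_smul, smul_smul, mul_div_cancel₀ _ h0, mul_div_cancel₀ _ h0]
        module
  convert hH using 1
  apply Set.Subset.antisymm
  · obtain ⟨A, hA⟩ := id hH
    rw [hA]
    have hl : ∀ l ∈ (vectorSpan ℝ G)ᗮ, ∀ a ∈ A, 0 ≤ ⟪a, l⟫_ℝ := by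
      intro l hl
      have : l ∈ {x | ∀ a ∈ A, 0 ≤ ⟪a, x⟫_ℝ} := by
        rw [← hA]
        exact ⟨0, by simp, by simpa using hl⟩
      exact this
    have hg : ∀ g ∈ s, ∀ a ∈ A, 0 ≤ ⟪a, g - q⟫_ℝ := by
      intro g hg
      have : g - q ∈ {x | ∀ a ∈ A, 0 ≤ ⟪a, x⟫_ℝ} := by
        rw [← hA]
        refine ⟨fun i => if i = e.symm ⟨g, hg⟩ then 1 else 0, fun i => ?_, ?_⟩
        · dsimp only; split_ifs <;> norm_num
        · simp
      exact this
    rintro _ ⟨_, ⟨c, _, ⟨x, hx, rfl⟩, hc, rfl⟩, l, hl', rfl⟩ a ha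
    dsimp only
    have hxa : 0 ≤ ⟪a, x - q⟫_ℝ := by
      have hsub : G ⊆ {x | ⟪a, q⟫_ℝ ≤ ⟪a, x⟫_ℝ} := by
        rw [hGs]
        refine convexHull_min ?_ (convex_halfSpace_ge (innerₛₗ ℝ a).isLinear _)
        intro g hg'
        have := hg g hg' a ha
        rw [inner_sub_right] at this
        show ⟪a, q⟫_ℝ ≤ ⟪a, g⟫_ℝ
        linarith
      have h' : ⟪a, q⟫_ℝ ≤ ⟪a, x⟫_ℝ := hsub hx
      rw [inner_sub_right]
      linarith
    rw [inner_add_right, real_inner_smul_right]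
    have := hl l hl' a ha
    positivity
  · rintro y ⟨c, hc, hy⟩
    obtain ⟨g0, hg0⟩ := hG.nonempty
    have h1 : y - ∑ i, c i • ((e i : Euc d) - q) ∈ innerCone F G :=
      ⟨0, ⟨0, _, ⟨g0, hg0, rfl⟩, le_rfl, by simp⟩, _, hy, by simp⟩
    have h2 : ∑ i, c i • ((e i : Euc d) - q) ∈ innerCone F G := by
      refine Finset.sum_induction _ (fun x => x ∈ innerCone F G) (fun a b ha hb => hadd a ha b hb)
        ⟨0, ⟨0, _, ⟨g0, hg0, rfl⟩, le_rfl, by simp⟩, 0, Submodule.zero_mem _, by simp⟩ ?_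
      intro i _
      refine ⟨_, ⟨c i, _, ⟨(e i : Euc d), ?_, rfl⟩, hc i, rfl⟩, 0, Submodule.zero_mem _, by simp [hq]⟩
      rw [hGs]
      exact subset_convexHull ℝ _ (e i).2
    have := hadd _ h1 _ h2
    simpa using this

lemma mem_innerCone_iff' {G F : Set (Euc d)} (hG : IsPolytope G) (hF : F ⊆ G) (hFc : Convex ℝ F)
    (hne : F.Nonempty) (y : Euc d) :
    y ∈ innerCone F G ↔ ∀ n ∈ normalCone F G, n ∈ vectorSpan ℝ G → ⟪n, y⟫_ℝ ≤ 0 := by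
  have hq := relPt_mem hFc hne
  have hqF := intrinsicInterior_subset hq
  constructor
  · rintro ⟨_, ⟨c, _, ⟨x, hx, rfl⟩, hc, rfl⟩, l, hl, rfl⟩ n hn hnG
    have h1 := hn _ hqF x hx
    have h2 : ⟪n, l⟫_ℝ = 0 := (Submodule.mem_orthogonal _ _).1 hl n hnG
    dsimp only
    rw [inner_add_right, real_inner_smul_right, inner_sub_right, h2]
    nlinarith
  · intro h
    by_contra hy
    obtain ⟨A, hA⟩ := isH_innerCone hG F
    have hy' := hy
    rw [hA] at hy'
    simp only [Set.mem_ofPred_eq, not_forall, not_le] at hy'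
    obtain ⟨a, ha, hay⟩ := hy'
    have hT : ∀ x ∈ innerCone F G, 0 ≤ ⟪a, x⟫_ℝ := by
      intro x hx; rw [hA] at hx; exact hx a ha
    have hgen : ∀ g ∈ G, 0 ≤ ⟪a, g - relPt F⟫_ℝ := fun g hg => hT _
      ⟨_, ⟨1, _, ⟨g, hg, rfl⟩, zero_le_one, rfl⟩, 0, Submodule.zero_mem _, by simp⟩
    have horth : ∀ l ∈ (vectorSpan ℝ G)ᗮ, 0 ≤ ⟪a, l⟫_ℝ := fun l hl => hT _
      ⟨0, ⟨0, _, ⟨_, hF hqF, rfl⟩, le_rfl, by simp⟩, l, hl, by simp⟩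
    have haG : a ∈ vectorSpan ℝ G := by
      rw [← Submodule.orthogonal_orthogonal (vectorSpan ℝ G), Submodule.mem_orthogonal']
      intro l hl
      have h1 := horth l hl
      have h2 := horth (-l) (Submodule.neg_mem _ hl)
      rw [inner_neg_right] at h2
      linarith
    have := h (-a) (fun x hx g hg => ?_) (Submodule.neg_mem _ haG)
    · rw [inner_neg_left] at this
      linarith
    · obtain ⟨ε, hε, hmem⟩ := relint_extend hq hx
      have h1 := hgen _ (hF hmem)
      have h2 := hgen g hg
      rw [add_sub_cancel_left, real_inner_smul_right, inner_sub_right] at h1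
      rw [inner_sub_right] at h2
      rw [inner_neg_left, inner_neg_left]
      have h3 : 0 ≤ ⟪a, relPt F⟫_ℝ - ⟪a, x⟫_ℝ := by
        by_contra hcon
        push Not at hcon
        nlinarith
      linarith

lemma mem_innerCone_iff {G : Set (Euc d)} (hG : IsPolytope G) (x0 y : Euc d) :
    y ∈ innerCone (maxFace G x0) G ↔ ∀ n, maxFace G n = maxFace G x0 →
      ⟪(vectorSpan ℝ G).starProjection n, y⟫_ℝ ≤ 0 := by
  rw [mem_innerCone_iff' hG (maxFace_subset _ _) (hG.maxFace x0).convex (maxFace_nonempty hG x0)]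
  constructor
  · intro h n hn
    refine h _ ?_ (Submodule.starProjection_apply_mem _ _)
    intro a ha b hb
    rw [← hn] at ha
    have h1 : ⟪(vectorSpan ℝ G).starProjection n, b - a⟫_ℝ = ⟪n, b - a⟫_ℝ := by
      rw [Submodule.inner_starProjection_left_eq_right, Submodule.starProjection_eq_self_iff.2]
      exact vsub_mem_vectorSpan ℝ hb ha.1
    have h2 := ha.2 b hb
    rw [inner_sub_right, inner_sub_right] at h1
    linarith
  · intro h n hn hnG
    by_contra hcon
    push Not at hcon
    obtain ⟨δ, hδ, h'⟩ := small_pos _ ⟪(vectorSpan ℝ G).starProjection x0, y⟫_ℝ hcon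
    rw [mem_normalCone_iff (maxFace_subset _ _)] at hn
    obtain ⟨p, hp⟩ := maxFace_nonempty hG x0
    have h1 := maxFace_add hδ (hn hp) hp
    rw [Set.inter_eq_right.2 hn] at h1
    have h2 := h _ h1
    rw [map_add, map_smul, inner_add_left, real_inner_smul_left,
      Submodule.starProjection_eq_self_iff.2 hnG] at h2
    linarith [h' δ hδ le_rfl]

lemma innerCone_self {G : Set (Euc d)} (hG : IsPolytope G) : innerCone G G = Set.univ := by
  ext y
  rw [mem_innerCone_iff' hG subset_rfl hG.convex hG.nonempty]
  simp only [Set.mem_univ, iff_true]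
  intro n hn hnG
  have h1 : n ∈ (vectorSpan ℝ G)ᗮ :=
    mem_vectorSpan_orth.2 fun a ha b hb => le_antisymm (hn b hb a ha) (hn a ha b hb)
  have h2 : ⟪n, n⟫_ℝ = 0 := (Submodule.mem_orthogonal _ _).1 h1 n hnG
  rw [inner_self_eq_zero.1 h2, inner_zero_left]

lemma le_vectorSpan_maxFace_iff {k : ℕ} {G : Set (Euc d)} {z : Fin k → Euc d} (hG : IsPolytope G)
    (h : Belt G z) (M : Submodule ℝ (Euc d))
    (hM : M ≤ Submodule.span ℝ {w | ∃ i, w = z i ∧ z i ∈ M}) (x : Euc d) :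
    M ≤ vectorSpan ℝ (maxFace G x) ↔ x ∈ Mᗮ := by
  rw [h.vectorSpan_maxFace hG]
  constructor
  · intro hle
    refine Submodule.orthogonal_le hle ?_
    rw [mem_span_orth]
    rintro w ⟨i, rfl, hi⟩
    exact hi
  · intro hx
    refine hM.trans (Submodule.span_mono ?_)
    rintro w ⟨i, rfl, hi⟩
    exact ⟨i, rfl, (Submodule.mem_orthogonal _ _).1 hx _ hi⟩

open Classical in
/-- Sum of the exterior angles over the faces parallel to a given flat. -/
lemma ext_sum {k : ℕ} {G : Set (Euc d)} {z : Fin k → Euc d} (hG : IsPolytope G)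
    (h : Belt G z) (M : Submodule ℝ (Euc d))
    (hM : M ≤ Submodule.span ℝ {w | ∃ i, w = z i ∧ z i ∈ M}) (α : ConeAngle d)
    (T : Finset (Set (Euc d)))
    (hT : ∀ F, F ∈ T ↔ (∃ x, F = maxFace G x) ∧ vectorSpan ℝ F = M) :
    ∑ F ∈ T, extAngle α F G = 1 := by
  let N : Finset (Euc d) := (Finset.univ.image (fun i => Mᗮ.starProjection (z i))).erase 0
  let C : Option (Set (Euc d)) → Set (Euc d) := fun o => o.elim Set.univ (fun F => outerCone F G)
  let a : Option (Set (Euc d)) → ℝ := fun o => o.elim (-1) (fun _ => 1)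
  have key := angle_generic α (Finset.insertNone T) C ?_ a N (by simp [N]) ?_
  · rw [Finset.sum_insertNone] at key
    simp only [C, a, Option.elim, α.norm', one_mul] at key
    have : ∑ F ∈ T, extAngle α F G = ∑ F ∈ T, α.toFun (outerCone F G) := rfl
    linarith
  · intro o ho
    cases o with
    | none => exact isH_univ
    | some F =>
      rw [Finset.some_mem_insertNone, hT] at ho
      obtain ⟨⟨x, rfl⟩, _⟩ := ho
      exact isH_outerCone hG h x
  · intro x hx
    rw [Finset.sum_insertNone]
    simp only [C, a, Option.elim, Set.indicator_univ]
    set p := Mᗮ.starProjection x with hp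
    have hpM : p ∈ Mᗮ := Submodule.starProjection_apply_mem _ _
    have hgen : ∀ i, z i ∉ M → ⟪z i, p⟫_ℝ ≠ 0 := by
      intro i hi
      rw [hp, ← Submodule.inner_starProjection_left_eq_right]
      apply hx
      simp only [N, Finset.mem_erase, Finset.mem_image, Finset.mem_univ, true_and]
      refine ⟨?_, i, rfl⟩
      intro h0
      apply hi
      rw [Submodule.starProjection_apply_eq_zero_iff, Submodule.orthogonal_orthogonal] at h0
      exact h0
    have hz : ∀ i, z i ∈ M → ⟪z i, p⟫_ℝ = 0 := fun i hi => (Submodule.mem_orthogonal _ _).1 hpM _ hi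
    have hL : vectorSpan ℝ (maxFace G p) = M := by
      refine le_antisymm ?_ ((le_vectorSpan_maxFace_iff hG h M hM p).2 hpM)
      rw [h.vectorSpan_maxFace hG, Submodule.span_le]
      rintro w ⟨i, rfl, hi⟩
      by_contra hc
      exact hgen i hc hi
    rw [Finset.sum_eq_single (maxFace G p)]
    · have : x ∈ outerCone (maxFace G p) G := by
        rw [outerCone_eq hG h, hL]
        intro i
        rw [Submodule.inner_starProjection_left_eq_right, ← hp]
        rw [sign_mul_self]
        exact abs_nonneg _
      rw [Set.indicator_of_mem this]
      norm_num
    · intro F hF hne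
      rw [hT] at hF
      obtain ⟨⟨y, rfl⟩, hy⟩ := hF
      apply Set.indicator_of_notMem
      intro hmem
      apply hne
      rw [outerCone_eq hG h, hy] at hmem
      rw [← h]
      have hyM : y ∈ Mᗮ := (le_vectorSpan_maxFace_iff hG h M hM y).1 hy.ge
      intro i
      by_cases hi : z i ∈ M
      · rw [hz i hi, (Submodule.mem_orthogonal _ _).1 hyM _ hi]
      · have h1 := hmem i
        rw [Submodule.inner_starProjection_left_eq_right, ← hp] at h1
        have h2 : ⟪z i, y⟫_ℝ ≠ 0 := by
          intro h0
          apply hi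
          rw [← hy, h.vectorSpan_maxFace hG]
          exact Submodule.subset_span ⟨i, rfl, h0⟩
        rcases lt_or_gt_of_ne (hgen i hi) with h3 | h3 <;> rcases lt_or_gt_of_ne h2 with h4 | h4
        · rw [sign_neg h3, sign_neg h4]
        · rw [sign_pos h4] at h1
          simp only [SignType.coe_one, one_mul] at h1
          linarith
        · rw [sign_neg h4] at h1
          simp only [SignType.coe_neg_one, neg_mul, one_mul] at h1
          linarith
        · rw [sign_pos h3, sign_pos h4]
    · intro hn
      exact absurd ((hT _).2 ⟨⟨p, rfl⟩, hL⟩) hn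

open Classical in
/-- Euler relation in terms of faces. -/
lemma belt_euler {k : ℕ} {G : Set (Euc d)} {z : Fin k → Euc d} (hG : IsPolytope G)
    (h : Belt G z) (M : Submodule ℝ (Euc d))
    (hM : M ≤ Submodule.span ℝ {w | ∃ i, w = z i ∧ z i ∈ M})
    (T : Finset (Set (Euc d)))
    (hT : ∀ F, F ∈ T ↔ (∃ x, F = maxFace G x) ∧ M ≤ vectorSpan ℝ F)
    (U : Set (Euc d)) (hU : RelOpen Mᗮ U) :
    ∑ F ∈ T, (if ∃ x ∈ U, maxFace G x = F then (-1 : ℝ) ^ (d + sdim F) else 0) =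
      if U.Nonempty then (-1) ^ Module.finrank ℝ (Mᗮ : Submodule ℝ (Euc d)) else 0 := by
  rw [← euler k (fun i => (innerSL ℝ (z i)).toLinearMap) Mᗮ U hU]
  rw [← Finset.sum_filter, ← Finset.sum_filter]
  symm
  refine Finset.sum_bij (fun σ hσ => maxFace G (Finset.mem_filter.1 hσ).2.choose) ?_ ?_ ?_ ?_
  · intro σ hσ
    have hs := (Finset.mem_filter.1 hσ).2.choose_spec
    rw [Finset.mem_filter, hT]
    exact ⟨⟨⟨_, rfl⟩, (le_vectorSpan_maxFace_iff hG h M hM _).2 (hU.sub _ hs.1)⟩, _, hs.1, rfl⟩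
  · intro σ hσ τ hτ heq
    have hs := (Finset.mem_filter.1 hσ).2.choose_spec
    have ht := (Finset.mem_filter.1 hτ).2.choose_spec
    have := (h _ _).2 heq
    funext i
    rw [← hs.2 i, ← ht.2 i]
    exact this i
  · intro F hF
    obtain ⟨hF, x, hx, rfl⟩ := Finset.mem_filter.1 hF
    have hσ : (fun i => SignType.sign ⟪z i, x⟫_ℝ) ∈ Finset.univ.filter
      (fun σ : Fin k → SignType => ∃ x ∈ U, ∀ i, SignType.sign
        ((innerSL ℝ (z i)).toLinearMap x) = σ i) := by
      simp only [Finset.mem_filter, Finset.mem_univ, true_and]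
      exact ⟨x, hx, fun i => rfl⟩
    refine ⟨_, hσ, ?_⟩
    rw [← h]
    exact (Finset.mem_filter.1 hσ).2.choose_spec.2
  · intro σ hσ
    have hs := (Finset.mem_filter.1 hσ).2.choose_spec
    set x := (Finset.mem_filter.1 hσ).2.choose
    have hle := (le_vectorSpan_maxFace_iff hG h M hM _).2 (hU.sub _ hs.1)
    have hcell : cellSpace (fun i => (innerSL ℝ (z i)).toLinearMap) Mᗮ σ
        = (vectorSpan ℝ (maxFace G x))ᗮ := by
      ext y
      rw [mem_cellSpace]
      constructor
      · rintro ⟨_, h2⟩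
        rw [h.vectorSpan_maxFace hG, mem_span_orth]
        rintro w ⟨i, rfl, hi⟩
        apply h2
        rw [← hs.2 i]
        exact sign_eq_zero_iff.2 hi
      · intro hy
        refine ⟨Submodule.orthogonal_le hle hy, fun i hi => ?_⟩
        rw [h.vectorSpan_maxFace hG, mem_span_orth] at hy
        refine hy _ ⟨i, rfl, ?_⟩
        rw [← hs.2 i] at hi
        exact sign_eq_zero_iff.1 hi
    rw [hcell]
    have := Submodule.finrank_add_finrank_orthogonal (vectorSpan ℝ (maxFace G x))
    rw [finrank_euclideanSpace_fin] at this
    have h3 : d + sdim (maxFace G x) = Module.finrank ℝ (vectorSpan ℝ (maxFace G x))ᗮ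
        + 2 * sdim (maxFace G x) := by
      unfold sdim; omega
    rw [h3, pow_add, pow_mul]
    simp

open Classical in
/-- Signed sum of the interior angles over the faces containing a given flat. -/
lemma int_sum {k : ℕ} {G : Set (Euc d)} {z : Fin k → Euc d} (hG : IsPolytope G)
    (h : Belt G z) (M : Submodule ℝ (Euc d))
    (hM : M ≤ Submodule.span ℝ {w | ∃ i, w = z i ∧ z i ∈ M}) (hlt : M < vectorSpan ℝ G)
    (α : ConeAngle d) (T : Finset (Set (Euc d)))
    (hT : ∀ F, F ∈ T ↔ (∃ x, F = maxFace G x) ∧ M ≤ vectorSpan ℝ F) :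
    ∑ F ∈ T, (-1 : ℝ) ^ (sdim F) * intAngle α F G = 0 := by
  obtain ⟨w, hwG, hwM⟩ := SetLike.exists_of_lt hlt
  obtain ⟨v, hvG, hvM, hv0⟩ : ∃ v ∈ vectorSpan ℝ G, v ∈ Mᗮ ∧ v ≠ 0 := by
    refine ⟨w - M.starProjection w, Submodule.sub_mem _ hwG
      (hlt.le (Submodule.starProjection_apply_mem _ _)),
      Submodule.sub_starProjection_mem_orthogonal _, ?_⟩
    intro h0
    apply hwM
    rw [sub_eq_zero.1 h0]
    exact Submodule.starProjection_apply_mem _ _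
  refine angle_generic α T (fun F => innerCone F G) (fun F _ => isH_innerCone hG F)
    (fun F => (-1 : ℝ) ^ (sdim F)) {v} (by simpa using hv0.symm) ?_
  intro c hc
  have hvc : ⟪v, c⟫_ℝ ≠ 0 := hc v (by simp)
  let U : Set (Euc d) := {x | x ∈ Mᗮ ∧ 0 < ⟪(vectorSpan ℝ G).starProjection x, c⟫_ℝ}
  have hU : RelOpen Mᗮ U := by
    refine ⟨fun x hx => hx.1, ?_, ?_⟩
    · intro x hx y hy a b ha hb hab
      refine ⟨Submodule.add_mem _ (Submodule.smul_mem _ _ hx.1) (Submodule.smul_mem _ _ hy.1), ?_⟩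
      rw [map_add, map_smul, map_smul, inner_add_left, real_inner_smul_left, real_inner_smul_left]
      rcases ha.eq_or_lt with rfl | ha
      · have : b = 1 := by linarith
        subst this
        have := hy.2
        linarith
      · have h1 := mul_pos ha hx.2
        have h2 := mul_nonneg hb hy.2.le
        linarith
    · intro x hx y hy
      obtain ⟨δ, hδ, hh⟩ := small_pos _ (⟪(vectorSpan ℝ G).starProjection y, c⟫_ℝ) hx.2
      refine ⟨δ, hδ, Submodule.add_mem _ hx.1 (Submodule.smul_mem _ _ hy), ?_⟩
      rw [map_add, map_smul, inner_add_left, real_inner_smul_left]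
      exact hh δ hδ le_rfl
  have hV : RelOpen Mᗮ ((Mᗮ : Submodule ℝ (Euc d)) : Set (Euc d)) :=
    ⟨fun x hx => hx, Submodule.convex _, fun x hx y hy => ⟨1, one_pos,
      Submodule.add_mem _ hx (Submodule.smul_mem _ _ hy)⟩⟩
  have hUne : U.Nonempty := by
    have hpv : (vectorSpan ℝ G).starProjection v = v := Submodule.starProjection_eq_self_iff.2 hvG
    rcases lt_or_gt_of_ne hvc with h1 | h1
    · refine ⟨-v, Submodule.neg_mem _ hvM, ?_⟩
      rw [map_neg, hpv, inner_neg_left]; linarith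
    · exact ⟨v, hvM, by rw [hpv]; exact h1⟩
  have e1 := belt_euler hG h M hM T hT U hU
  have e2 := belt_euler hG h M hM T hT _ hV
  rw [if_pos hUne] at e1
  rw [if_pos ⟨0, Submodule.zero_mem _⟩, ← e1, ← sub_eq_zero, ← Finset.sum_sub_distrib] at e2
  have e3 : ∑ F ∈ T, (-1 : ℝ) ^ d * (innerCone F G).indicator (fun _ => (-1 : ℝ) ^ (sdim F)) c = 0 := by
    rw [← e2]
    refine Finset.sum_congr rfl ?_
    intro F hF
    rw [hT] at hF
    obtain ⟨⟨x0, rfl⟩, hle⟩ := hF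
    have hx0 := (le_vectorSpan_maxFace_iff hG h M hM x0).1 hle
    rw [if_pos ⟨x0, hx0, rfl⟩]
    by_cases hin : c ∈ innerCone (maxFace G x0) G
    · rw [Set.indicator_of_mem hin, if_neg, sub_zero, pow_add]
      rintro ⟨x, hx, hxF⟩
      have := (mem_innerCone_iff hG x0 c).1 hin x hxF
      exact absurd hx.2 (not_lt.2 this)
    · rw [Set.indicator_of_notMem hin, if_pos, sub_self, mul_zero]
      rw [mem_innerCone_iff hG] at hin
      push Not at hin
      obtain ⟨n, hn, hpos⟩ := hin
      refine ⟨n, ⟨?_, hpos⟩, hn⟩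
      rw [← le_vectorSpan_maxFace_iff hG h M hM, hn]
      exact hle
  rw [← Finset.mul_sum] at e3
  exact (mul_eq_zero.1 e3).resolve_left (by simp)

lemma finite_chains {β : Type*} [PartialOrder β] [Finite β] (a c : β) :
    (chainsFromTo a c).Finite := by
  have : (chainsFromTo a c) ⊆ {l : List β | l.Nodup} := by
    rintro l ⟨h, _⟩
    exact (List.isChain_iff_pairwise.1 h).imp (fun h => ne_of_lt h)
  refine Set.Finite.subset ?_ this
  have := Fintype.ofFinite β
  refine Set.Finite.subset (List.finite_length_le β (Fintype.card β)) ?_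
  intro l hl
  exact List.Nodup.length_le_card hl

lemma chain_head_le {β : Type*} [PartialOrder β] (l : List β) (a c : β)
    (h : l ∈ chainsFromTo a c) : a ≤ c := by
  obtain ⟨h1, h2, h3⟩ := h
  cases l with
  | nil => simp at h2
  | cons x l =>
    simp only [List.head?_cons, Option.some.injEq] at h2
    subst h2
    have hp := List.isChain_iff_pairwise.1 h1
    rw [List.pairwise_cons] at hp
    cases l with
    | nil => simp at h3; exact h3.le
    | cons y l =>
      rw [List.getLast?_cons_cons] at h3
      exact (hp.1 c (List.mem_of_getLast? h3)).le

lemma mob_not_le {β : Type*} [PartialOrder β] (a c : β) (h : ¬ a ≤ c) : mob a c = 0 := by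
  have : chainsFromTo a c = ∅ := by
    ext l
    constructor
    · intro hl; exact absurd (chain_head_le l a c hl) h
    · intro hl; exact hl.elim
  rw [mob, this, finsum_mem_empty]

lemma mob_self {β : Type*} [PartialOrder β] (a : β) : mob a a = 1 := by
  have : chainsFromTo a a = {[a]} := by
    ext l
    constructor
    · rintro ⟨h1, h2, h3⟩
      cases l with
      | nil => simp at h2
      | cons x l =>
        simp only [List.head?_cons, Option.some.injEq] at h2
        subst h2
        have hp := List.isChain_iff_pairwise.1 h1
        rw [List.pairwise_cons] at hp
        cases l with
        | nil => rfl
        | cons y l =>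
          rw [List.getLast?_cons_cons] at h3
          exact absurd (hp.1 x (List.mem_of_getLast? h3)) (lt_irrefl _)
    · rintro rfl
      exact ⟨List.isChain_singleton _, rfl, rfl⟩
  rw [mob, this, finsum_mem_singleton]
  norm_num

lemma mob_rec {β : Type*} [PartialOrder β] [Finite β] (a c : β) (h : a ≠ c) :
    mob a c = - ∑ᶠ b ∈ {b : β | a < b}, mob b c := by
  have hc : chainsFromTo a c = ⋃ b ∈ {b : β | a < b}, (List.cons a) '' chainsFromTo b c := by
    ext l
    simp only [Set.mem_iUnion, Set.mem_image, exists_prop, Set.mem_ofPred_eq]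
    constructor
    · rintro ⟨h1, h2, h3⟩
      cases l with
      | nil => simp at h2
      | cons x l =>
        simp only [List.head?_cons, Option.some.injEq] at h2
        subst h2
        cases l with
        | nil => simp at h3; exact absurd h3 h
        | cons y l =>
          rw [List.getLast?_cons_cons] at h3
          have h1 := List.isChain_cons_cons.1 h1
          exact ⟨y, h1.1, y :: l, ⟨h1.2, rfl, h3⟩, rfl⟩
    · rintro ⟨b, hb, l, ⟨h1, h2, h3⟩, rfl⟩
      cases l with
      | nil => simp at h2
      | cons x l =>
        simp only [List.head?_cons, Option.some.injEq] at h2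
        subst h2
        exact ⟨List.isChain_cons_cons.2 ⟨hb, h1⟩, rfl, by rw [List.getLast?_cons_cons]; exact h3⟩
  rw [mob, hc, finsum_mem_biUnion]
  · rw [← finsum_mem_neg_distrib _ (Set.toFinite _)]
    refine finsum_mem_congr rfl ?_
    intro b _
    rw [finsum_mem_image (List.cons_injective.injOn), mob,
      ← finsum_mem_neg_distrib _ (finite_chains b c)]
    refine finsum_mem_congr rfl ?_
    intro l _
    rw [List.length_cons, pow_succ]
    ring
  · intro b _ b' _ hne
    rw [Function.onFun, Set.disjoint_left]
    rintro _ ⟨l, hl, rfl⟩ ⟨l', hl', h2⟩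
    have := List.cons_injective h2
    subst this
    have h3 := hl.2.1
    rw [hl'.2.1] at h3
    exact hne (Option.some.inj h3).symm
  · exact Set.toFinite _
  · intro b _
    exact (finite_chains b c).image _

open Classical in
lemma eq_mob {β : Type*} [PartialOrder β] [Fintype β] (c : β) (g : β → ℝ) (h1 : g c = 1)
    (h2 : ∀ a, ¬ a ≤ c → g a = 0)
    (h3 : ∀ a, a < c → ∑ b, (if a ≤ b then g b else 0) = 0) (a : β) : g a = mob a c := by
  induction a using WellFoundedGT.induction with
  | ind a ih =>
    by_cases hac : a ≤ c
    · rcases hac.eq_or_lt with rfl | hlt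
      · rw [h1, mob_self]
      · rw [mob_rec a c hlt.ne]
        have e : ∑ᶠ b ∈ {b : β | a < b}, mob b c = ∑ b, (if a < b then g b else 0) := by
          rw [finsum_eq_sum_of_fintype]
          refine Finset.sum_congr rfl fun b _ => ?_
          rw [finsum_eq_if]
          by_cases hb : a < b
          · simp [hb, ih b hb]
          · simp [hb]
        rw [e]
        have := h3 a hlt
        have e2 : ∀ b, (if a ≤ b then g b else 0) = (if b = a then g b else 0) +
            (if a < b then g b else 0) := by
          intro b
          by_cases hb : b = a
          · subst hb; simp
          · by_cases hb2 : a ≤ b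
            · simp [hb, hb2, lt_of_le_of_ne hb2 (Ne.symm hb)]
            · have : ¬ a < b := fun h => hb2 h.le
              simp [hb, hb2, this]
        simp only [e2, Finset.sum_add_distrib, Finset.sum_ite_eq', Finset.mem_univ, if_true] at this
        linarith
    · rw [h2 a hac, mob_not_le a c hac]

lemma finite_faces {k : ℕ} {P : Set (Euc d)} {z : Fin k → Euc d}
    (h : Belt P z) : Finite {F : Set (Euc d) // IsFace P F} := by
  classical
  let φ : (Fin k → SignType) → Set (Euc d) := fun σ =>
    if h : ∃ x : Euc d, ∀ i, SignType.sign ⟪z i, x⟫_ℝ = σ i then maxFace P h.choose else ∅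
  have hfin : (insert ∅ (Set.range φ)).Finite := (Set.finite_range φ).insert _
  refine Set.Finite.to_subtype (s := {F | IsFace P F}) (hfin.subset ?_)
  intro F hF
  rcases Set.eq_empty_or_nonempty F with rfl | hne
  · exact Set.mem_insert _ _
  · right
    obtain ⟨c, rfl⟩ := face_eq_maxFace hF hne
    refine ⟨fun i => SignType.sign ⟪z i, c⟫_ℝ, ?_⟩
    have hex : ∃ x : Euc d, ∀ i, SignType.sign ⟪z i, x⟫_ℝ = SignType.sign ⟪z i, c⟫_ℝ :=
      ⟨c, fun i => rfl⟩
    simp only [φ]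
    rw [dif_pos hex]
    exact (h _ _).1 hex.choose_spec

/-- A face with the same linear span is the whole polytope. -/
lemma maxFace_eq_of_span {G : Set (Euc d)} (x : Euc d)
    (h : vectorSpan ℝ (maxFace G x) = vectorSpan ℝ G) : maxFace G x = G := by
  have hx : x ∈ (vectorSpan ℝ (maxFace G x))ᗮ :=
    mem_vectorSpan_orth.2 fun a ha b hb => maxFace_inner_eq ha hb
  rw [h, mem_vectorSpan_orth] at hx
  refine Set.Subset.antisymm (maxFace_subset _ _) ?_
  intro a ha
  exact ⟨ha, fun y hy => (hx y hy a ha).le⟩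

/-- Spanning condition for flats contained in `L(G)`. -/
lemma flat_span {k : ℕ} {P : Set (Euc d)} {z : Fin k → Euc d} (hP : IsPolytope P)
    (h : Belt P z) (c c' : Euc d) (hle : vectorSpan ℝ (maxFace P c') ≤ vectorSpan ℝ (maxFace P c)) :
    vectorSpan ℝ (maxFace P c') ≤ Submodule.span ℝ
      {w | ∃ i, w = locz z c i ∧ locz z c i ∈ vectorSpan ℝ (maxFace P c')} := by
  conv_lhs => rw [h.vectorSpan_maxFace hP c']
  refine Submodule.span_mono ?_
  rintro w ⟨i, rfl, hi⟩
  have h1 : z i ∈ vectorSpan ℝ (maxFace P c') := by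
    rw [h.vectorSpan_maxFace hP c']
    exact Submodule.subset_span ⟨i, rfl, hi⟩
  have h2 : ⟪z i, c⟫_ℝ = 0 := by
    have h3 := hle h1
    rw [h.vectorSpan_maxFace hP c] at h3
    have h4 : c ∈ (Submodule.span ℝ {w | ∃ i, w = z i ∧ ⟪z i, c⟫_ℝ = 0})ᗮ := by
      rw [mem_span_orth]
      rintro w ⟨j, rfl, hj⟩
      exact hj
    exact (Submodule.mem_orthogonal _ _).1 h4 _ h3
  have h5 : locz z c i = z i := by simp [locz, h2]
  exact ⟨i, h5.symm, by rw [h5]; exact h1⟩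

lemma face_sub_iff {P : Set (Euc d)} (hP : IsPolytope P) (c : Euc d) (F : Set (Euc d)) :
    (IsFace P F ∧ F.Nonempty ∧ F ⊆ maxFace P c) ↔ ∃ x, F = maxFace (maxFace P c) x := by
  constructor
  · rintro ⟨hF, hne, hsub⟩
    obtain ⟨x, rfl⟩ := face_eq_maxFace hF hne
    exact ⟨x, maxFace_of_subset hP hsub (maxFace_subset _ _)⟩
  · rintro ⟨x, rfl⟩
    refine ⟨?_, maxFace_nonempty (hP.maxFace c) x, maxFace_subset _ _⟩
    obtain ⟨y, hy⟩ := face_face hP c x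
    rw [hy]
    exact isExposed_maxFace P y

open Classical in
lemma sum_faces {P : Set (Euc d)} (hP : IsPolytope P) [Fintype {F : Set (Euc d) // IsFace P F}]
    (c : Euc d) (p : Set (Euc d) → Prop) (f : Set (Euc d) → ℝ) :
    ∃ T : Finset (Set (Euc d)), (∀ F, F ∈ T ↔ (∃ x, F = maxFace (maxFace P c) x) ∧ p F) ∧
      ∑ F : {F : Set (Euc d) // IsFace P F},
        (if F.1.Nonempty ∧ F.1 ⊆ maxFace P c ∧ p F.1 then f F.1 else 0) = ∑ F ∈ T, f F := by
  refine ⟨(Finset.univ.filter (fun F : {F : Set (Euc d) // IsFace P F} =>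
    F.1.Nonempty ∧ F.1 ⊆ maxFace P c ∧ p F.1)).image Subtype.val, ?_, ?_⟩
  · intro F
    rw [← face_sub_iff hP]
    simp only [Finset.mem_image, Finset.mem_filter, Finset.mem_univ, true_and, Subtype.exists,
      exists_and_right, exists_eq_right]
    tauto
  · rw [Finset.sum_image (fun a _ b _ hab => Subtype.ext hab), Finset.sum_filter]

lemma LMap_empty {P : Set (Euc d)} (F : {F : Set (Euc d) // IsFace P F}) (h : F.1 = ∅) :
    (LMap P F).1 = ∅ := by
  have : LMap P F = ⟨∅, Or.inl rfl⟩ := dif_pos h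
  rw [this]

lemma LMap_ne {P : Set (Euc d)} (F : {F : Set (Euc d) // IsFace P F}) (h : F.1 ≠ ∅) :
    (LMap P F).1 = (vectorSpan ℝ F.1 : Submodule ℝ (Euc d)) := by
  have : LMap P F = ⟨((vectorSpan ℝ F.1 : Submodule ℝ (Euc d)) : Set (Euc d)),
    Or.inr ⟨F.1, F.2, Set.nonempty_iff_ne_empty.2 h, rfl⟩⟩ := dif_neg h
  rw [this]

lemma LMap_eq_empty_iff {P : Set (Euc d)} (F : {F : Set (Euc d) // IsFace P F}) :
    (LMap P F).1 = ∅ ↔ F.1 = ∅ := by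
  constructor
  · intro h
    by_contra hne
    rw [LMap_ne F hne] at h
    exact Set.notMem_empty (0 : Euc d) (h ▸ Submodule.zero_mem (vectorSpan ℝ F.1))
  · exact LMap_empty F

lemma LMap_mono {P : Set (Euc d)} (F G : {F : Set (Euc d) // IsFace P F}) (h : F.1 ⊆ G.1) :
    LMap P F ≤ LMap P G := by
  change (LMap P F).1 ⊆ (LMap P G).1
  by_cases hF : F.1 = ∅
  · rw [LMap_empty F hF]; exact Set.empty_subset _
  · have hG : G.1 ≠ ∅ := fun h0 => hF (Set.subset_empty_iff.1 (h0 ▸ h))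
    rw [LMap_ne F hF, LMap_ne G hG]
    exact vectorSpan_mono ℝ h

lemma isFace_empty (P : Set (Euc d)) : IsFace P ∅ := fun h => absurd h Set.not_nonempty_empty

lemma LMap_surj (P : Set (Euc d)) : Function.Surjective (LMap P) := by
  rintro ⟨A, hA⟩
  rcases hA with rfl | ⟨F, hF, hne, rfl⟩
  · exact ⟨⟨∅, isFace_empty P⟩, Subtype.ext (LMap_empty _ rfl)⟩
  · exact ⟨⟨F, hF⟩, Subtype.ext (LMap_ne _ hne.ne_empty)⟩

lemma rkFace_eq {P : Set (Euc d)} (F F' : {F : Set (Euc d) // IsFace P F})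
    (h : LMap P F = LMap P F') : rkFace F.1 = rkFace F'.1 := by
  have h' := congrArg Subtype.val h
  by_cases hF : F.1 = ∅
  · have hF' : F'.1 = ∅ := by
      rw [← LMap_eq_empty_iff, ← h', LMap_eq_empty_iff]; exact hF
    rw [hF, hF']
  · have hF' : F'.1 ≠ ∅ := by
      rw [Ne, ← LMap_eq_empty_iff, ← h', LMap_eq_empty_iff]; exact hF
    rw [LMap_ne F hF, LMap_ne F' hF'] at h'
    rw [rkFace, rkFace, if_neg hF, if_neg hF', sdim, sdim, SetLike.coe_injective h']

open Classical in
lemma ext_col {k : ℕ} {P : Set (Euc d)} {z : Fin k → Euc d} (hP : IsPolytope P)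
    (h : Belt P z) [Fintype {F : Set (Euc d) // IsFace P F}] (α : ConeAngle d)
    (q : Flats0 P) (G : {F : Set (Euc d) // IsFace P F}) :
    ∑ F, (if LMap P F = q then extA α P F G else 0) = if q ≤ LMap P G then 1 else 0 := by
  by_cases hle : q ≤ LMap P G
  swap
  · rw [if_neg hle]
    refine Finset.sum_eq_zero fun F _ => ?_
    split_ifs with h1
    · rw [extA, if_neg]
      intro hsub
      exact hle (h1 ▸ LMap_mono F G hsub)
    · rfl
  rw [if_pos hle]
  obtain ⟨H, rfl⟩ := LMap_surj P q
  by_cases hH : H.1 = ∅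
  · rw [Finset.sum_eq_single H]
    · rw [if_pos rfl, extA, if_pos (by rw [hH]; exact Set.empty_subset _), if_pos hH]
    · intro F _ hne
      rw [if_neg]
      intro heq
      have := (LMap_eq_empty_iff F).1 (by rw [heq]; exact LMap_empty H hH)
      exact hne (Subtype.ext (this.trans hH.symm))
    · simp
  · have hG : G.1 ≠ ∅ := by
      intro hG
      have hle' : (LMap P H).1 ⊆ (LMap P G).1 := hle
      rw [LMap_empty G hG] at hle'
      exact hH ((LMap_eq_empty_iff H).1 (Set.subset_empty_iff.1 hle'))
    have hle' : (LMap P H).1 ⊆ (LMap P G).1 := hle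
    rw [LMap_ne H hH, LMap_ne G hG] at hle'
    obtain ⟨c', hc'⟩ := face_eq_maxFace H.2 (Set.nonempty_iff_ne_empty.2 hH)
    obtain ⟨c, hc⟩ := face_eq_maxFace G.2 (Set.nonempty_iff_ne_empty.2 hG)
    rw [hc', hc] at hle'
    obtain ⟨T, hT, hsum⟩ := sum_faces hP c (fun F => vectorSpan ℝ F = vectorSpan ℝ (maxFace P c'))
      (fun F => extAngle α F (maxFace P c))
    rw [ext_sum (hP.maxFace c) (h.face hP c) _ (flat_span hP h c c' hle') α T hT] at hsum
    rw [← hsum]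
    refine Finset.sum_congr rfl fun F _ => ?_
    by_cases hF : F.1 = ∅
    · rw [if_neg, if_neg]
      · rw [hF]; simp
      · intro h1
        exact hH ((LMap_eq_empty_iff H).1 (by rw [← h1]; exact LMap_empty F hF))
    · have hiff : LMap P F = LMap P H ↔ vectorSpan ℝ F.1 = vectorSpan ℝ (maxFace P c') := by
        rw [← hc']
        constructor
        · intro h1
          have h2 := congrArg Subtype.val h1
          rw [LMap_ne F hF, LMap_ne H hH] at h2
          exact SetLike.coe_injective h2
        · intro h1
          apply Subtype.ext
          rw [LMap_ne F hF, LMap_ne H hH, h1]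
      have hne := Set.nonempty_iff_ne_empty.2 hF
      rw [extA, if_neg hF, ← hc]
      by_cases h1 : LMap P F = LMap P H <;> by_cases h2 : F.1 ⊆ G.1
      · rw [if_pos h1, if_pos h2, if_pos ⟨hne, h2, hiff.1 h1⟩]
      · rw [if_pos h1, if_neg h2, if_neg fun h3 => h2 h3.2.1]
      · rw [if_neg h1, if_neg fun h3 => h1 (hiff.2 h3.2.2)]
      · rw [if_neg h1, if_neg fun h3 => h2 h3.2.1]

/-- The signed interior angle at a nonempty face. -/
lemma intA'_nonempty {P : Set (Euc d)} (α : ConeAngle d) (F G : {F : Set (Euc d) // IsFace P F})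
    (hF : F.1.Nonempty) (hsub : F.1 ⊆ G.1) :
    intA' α P F G = (-1) ^ sdim G.1 * ((-1) ^ sdim F.1 * intAngle α F.1 G.1) := by
  have hG := (hF.mono hsub).ne_empty
  rw [intA', intA, if_pos hsub, if_neg hF.ne_empty, rkFace, rkFace, if_neg hG, if_neg hF.ne_empty]
  have hd : sdim F.1 ≤ sdim G.1 := Submodule.finrank_mono (vectorSpan_mono ℝ hsub)
  obtain ⟨e, he⟩ := Nat.exists_eq_add_of_le hd
  rw [he, ← mul_assoc, ← pow_add]
  have : sdim F.1 + e + 1 - (sdim F.1 + 1) = e := by omega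
  rw [this, show sdim F.1 + e + sdim F.1 = e + 2 * sdim F.1 by ring, pow_add _ e, pow_mul]
  simp

lemma intA'_not_sub {P : Set (Euc d)} (α : ConeAngle d) (F G : {F : Set (Euc d) // IsFace P F})
    (hsub : ¬ F.1 ⊆ G.1) : intA' α P F G = 0 := by
  rw [intA', intA, if_neg hsub, mul_zero]

lemma sub_eq_of_span {P : Set (Euc d)} (hP : IsPolytope P)
    (F G : {F : Set (Euc d) // IsFace P F}) (hF : F.1.Nonempty)
    (hsub : F.1 ⊆ G.1) (hs : vectorSpan ℝ F.1 = vectorSpan ℝ G.1) : F = G := by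
  obtain ⟨c, hc⟩ := face_eq_maxFace G.2 (hF.mono hsub)
  obtain ⟨x, hx⟩ := (face_sub_iff hP c F.1).1 ⟨F.2, hF, hc ▸ hsub⟩
  apply Subtype.ext
  rw [hx, hc]
  apply maxFace_eq_of_span
  rw [← hx, hs, hc]

lemma intA'_self {P : Set (Euc d)} (hP : IsPolytope P) (α : ConeAngle d)
    (G : {F : Set (Euc d) // IsFace P F}) : intA' α P G G = 1 := by
  rw [intA', intA, Nat.sub_self, if_pos (Set.Subset.refl _)]
  by_cases hG : G.1 = ∅
  · rw [if_pos hG, if_pos]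
    · norm_num
    · rw [hG, sdim, vectorSpan_empty]; simp
  · rw [if_neg hG]
    obtain ⟨c, hc⟩ := face_eq_maxFace G.2 (Set.nonempty_iff_ne_empty.2 hG)
    rw [intAngle, hc, innerCone_self (hP.maxFace c), α.norm']
    norm_num

open Classical in
/-- The vanishing of the signed sum over faces above a flat. -/
lemma int_col {k : ℕ} {P : Set (Euc d)} {z : Fin k → Euc d} (hP : IsPolytope P)
    (h : Belt P z) [Fintype {F : Set (Euc d) // IsFace P F}] (α : ConeAngle d)
    (c : Euc d) (G : {F : Set (Euc d) // IsFace P F}) (hc : G.1 = maxFace P c)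
    (M : Submodule ℝ (Euc d))
    (hM : M ≤ Submodule.span ℝ {w | ∃ i, w = locz z c i ∧ locz z c i ∈ M})
    (hlt : M < vectorSpan ℝ G.1) :
    ∑ F, (if F.1.Nonempty ∧ M ≤ vectorSpan ℝ F.1 then intA' α P F G else 0) = 0 := by
  rw [hc] at hlt
  obtain ⟨T, hT, hsum⟩ := sum_faces hP c (fun F => M ≤ vectorSpan ℝ F)
    (fun F => (-1 : ℝ) ^ sdim F * intAngle α F (maxFace P c))
  rw [int_sum (hP.maxFace c) (h.face hP c) M hM hlt α T hT] at hsum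
  refine Eq.trans ?_ ((congrArg (fun t => (-1 : ℝ) ^ sdim G.1 * t) hsum).trans (mul_zero _))
  simp only [Finset.mul_sum]
  refine Finset.sum_congr rfl fun F _ => ?_
  rw [← hc]
  by_cases h1 : F.1.Nonempty ∧ M ≤ vectorSpan ℝ F.1
  · by_cases h2 : F.1 ⊆ G.1
    · rw [if_pos h1, if_pos ⟨h1.1, h2, h1.2⟩, intA'_nonempty α F G h1.1 h2]
    · rw [if_pos h1, if_neg fun h3 => h2 h3.2.1, intA'_not_sub α F G h2, mul_zero]
  · rw [if_neg h1, if_neg fun h3 => h1 ⟨h3.1, h3.2.2⟩, mul_zero]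

open Classical in
lemma int_up {k : ℕ} {P : Set (Euc d)} {z : Fin k → Euc d} (hP : IsPolytope P)
    (h : Belt P z) [Fintype {F : Set (Euc d) // IsFace P F}] (α : ConeAngle d)
    (q : Flats0 P) (G : {F : Set (Euc d) // IsFace P F}) (hlt : q < LMap P G) :
    ∑ F, (if q ≤ LMap P F then intA' α P F G else 0) = 0 := by
  obtain ⟨H, rfl⟩ := LMap_surj P q
  have hlt' : (LMap P H).1 ⊂ (LMap P G).1 := hlt
  have hG : G.1 ≠ ∅ := by
    intro hG
    rw [LMap_empty G hG] at hlt'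
    exact hlt'.2 (Set.empty_subset _)
  obtain ⟨c, hc⟩ := face_eq_maxFace G.2 (Set.nonempty_iff_ne_empty.2 hG)
  by_cases hH : H.1 = ∅
  · have hall : ∀ F, LMap P H ≤ LMap P F := fun F =>
      LMap_mono H F (by rw [hH]; exact Set.empty_subset _)
    simp only [hall, if_true]
    have hsplit : ∀ F : {F : Set (Euc d) // IsFace P F}, intA' α P F G =
        (if F = H then intA' α P H G else 0) +
        (if F.1.Nonempty ∧ ⊥ ≤ vectorSpan ℝ F.1 then intA' α P F G else 0) := by
      intro F
      by_cases hF : F = H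
      · subst hF
        rw [if_pos rfl, if_neg, add_zero]
        rw [hH]; simp
      · have hne : F.1.Nonempty := by
          rw [Set.nonempty_iff_ne_empty]
          intro h0
          exact hF (Subtype.ext (h0.trans hH.symm))
        rw [if_neg hF, if_pos ⟨hne, bot_le⟩, zero_add]
    rw [Finset.sum_congr rfl fun F _ => hsplit F, Finset.sum_add_distrib, Finset.sum_ite_eq',
      if_pos (Finset.mem_univ _)]
    have hHval : intA' α P H G = if sdim G.1 = 0 then -1 else 0 := by
      rw [intA', intA, if_pos (by rw [hH]; exact Set.empty_subset _), if_pos hH, rkFace, rkFace,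
        if_neg hG, if_pos hH]
      by_cases h0 : sdim G.1 = 0
      · simp [h0]
      · simp [h0]
    rw [hHval]
    by_cases h0 : sdim G.1 = 0
    · rw [if_pos h0]
      have hbot : vectorSpan ℝ G.1 = ⊥ := Submodule.finrank_eq_zero.1 h0
      rw [Finset.sum_eq_single G]
      · rw [if_pos ⟨Set.nonempty_iff_ne_empty.2 hG, bot_le⟩, intA'_self hP]
        norm_num
      · intro F _ hne
        split_ifs with h1
        · apply intA'_not_sub
          intro hsub
          apply hne
          refine sub_eq_of_span hP F G h1.1 hsub ?_
          rw [hbot, eq_bot_iff, ← hbot]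
          exact vectorSpan_mono ℝ hsub
        · rfl
      · simp
    · rw [if_neg h0, int_col hP h α c G hc ⊥ bot_le, add_zero]
      rw [bot_lt_iff_ne_bot]
      intro hb
      exact h0 (by rw [sdim, hb]; simp)
  · obtain ⟨c', hc'⟩ := face_eq_maxFace H.2 (Set.nonempty_iff_ne_empty.2 hH)
    rw [LMap_ne H hH, LMap_ne G hG] at hlt'
    have hlt2 : vectorSpan ℝ H.1 < vectorSpan ℝ G.1 := hlt'
    have hsp := flat_span hP h c c' (by rw [← hc, ← hc']; exact hlt2.le)
    rw [← hc'] at hsp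
    refine Eq.trans ?_ (int_col hP h α c G hc (vectorSpan ℝ H.1) hsp hlt2)
    refine Finset.sum_congr rfl fun F _ => ?_
    congr 1
    apply propext
    change (LMap P H).1 ⊆ (LMap P F).1 ↔ _
    rw [LMap_ne H hH]
    by_cases hF : F.1 = ∅
    · rw [LMap_empty F hF]
      constructor
      · intro h1
        exact absurd (h1 (Submodule.zero_mem _)) (Set.notMem_empty _)
      · rintro ⟨h1, _⟩
        exact absurd hF h1.ne_empty
    · rw [LMap_ne F hF]
      exact ⟨fun h1 => ⟨Set.nonempty_iff_ne_empty.2 hF, h1⟩, fun h1 => h1.2⟩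

open Classical in
lemma int_mob {k : ℕ} {P : Set (Euc d)} {z : Fin k → Euc d} (hP : IsPolytope P)
    (h : Belt P z) [Fintype {F : Set (Euc d) // IsFace P F}] (α : ConeAngle d)
    (q : Flats0 P) (G : {F : Set (Euc d) // IsFace P F}) :
    ∑ F, (if LMap P F = q then intA' α P F G else 0) = mob q (LMap P G) := by
  have : Finite (Flats0 P) := Finite.of_surjective _ (LMap_surj P)
  have := Fintype.ofFinite (Flats0 P)
  refine eq_mob (LMap P G) (fun q => ∑ F, (if LMap P F = q then intA' α P F G else 0)) ?_ ?_ ?_ q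
  · beta_reduce
    rw [Finset.sum_eq_single G]
    · rw [if_pos rfl, intA'_self hP]
    · intro F _ hne
      split_ifs with h1
      · apply intA'_not_sub
        intro hsub
        apply hne
        by_cases hF : F.1 = ∅
        · apply Subtype.ext
          rw [hF]
          exact ((LMap_eq_empty_iff G).1 (by rw [← h1]; exact LMap_empty F hF)).symm
        · have hG : G.1 ≠ ∅ := fun h0 => hF (Set.subset_empty_iff.1 (h0 ▸ hsub))
          refine sub_eq_of_span hP F G (Set.nonempty_iff_ne_empty.2 hF) hsub ?_
          have h2 := congrArg Subtype.val h1
          rw [LMap_ne F hF, LMap_ne G hG] at h2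
          exact SetLike.coe_injective h2
      · rfl
    · simp
  · intro a ha
    refine Finset.sum_eq_zero fun F _ => ?_
    split_ifs with h1
    · apply intA'_not_sub
      intro hsub
      exact ha (h1 ▸ LMap_mono F G hsub)
    · rfl
  · intro a ha
    refine Eq.trans ?_ (int_up hP h α a G ha)
    have : ∀ b : Flats0 P, (if a ≤ b then ∑ F, (if LMap P F = b then intA' α P F G else 0) else 0)
        = ∑ F, (if LMap P F = b then (if a ≤ LMap P F then intA' α P F G else 0) else 0) := by
      intro b
      by_cases hb : a ≤ b
      · rw [if_pos hb]
        refine Finset.sum_congr rfl fun F _ => ?_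
        split_ifs with h1 h2
        · rfl
        · exact absurd (h1 ▸ hb) h2
        · rfl
      · rw [if_neg hb]
        symm
        refine Finset.sum_eq_zero fun F _ => ?_
        split_ifs with h1 h2
        · exact absurd (h1 ▸ h2) hb
        · rfl
        · rfl
    rw [Finset.sum_congr rfl fun b _ => this b, Finset.sum_comm]
    refine Finset.sum_congr rfl fun F _ => ?_
    rw [Finset.sum_ite_eq, if_pos (Finset.mem_univ _)]

open Classical in
lemma finsum_fiber {β γ : Type*} [Fintype β] (φ : β → γ) (q : γ) (f : β → ℝ) :
    ∑ᶠ (p : β) (_ : φ p = q), f p = ∑ p, if φ p = q then f p else 0 := by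
  rw [finsum_eq_sum_of_fintype]
  refine Finset.sum_congr rfl fun b _ => ?_
  rw [finsum_eq_if]

open Classical in
lemma pushf_eq {β γ : Type*} [Fintype β] (φ : β → γ) (hφ : Function.Surjective φ)
    (h : β → β → ℝ) (K : γ → γ → ℝ)
    (hK : ∀ q p', ∑ p, (if φ p = q then h p p' else 0) = K q (φ p')) (q q' : γ) :
    pushf φ h q q' = K q q' := by
  have hcard : (Nat.card {p : β // φ p = q'} : ℝ) ≠ 0 := by
    obtain ⟨p, hp⟩ := hφ q'
    have : Nonempty {p : β // φ p = q'} := ⟨⟨p, hp⟩⟩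
    exact_mod_cast Nat.card_pos.ne'
  rw [pushf, finsum_fiber]
  simp only [finsum_fiber]
  have e : ∀ p, (if φ p = q then ∑ p', (if φ p' = q' then h p p' else 0) else 0)
      = ∑ p', (if φ p' = q' then (if φ p = q then h p p' else 0) else 0) := by
    intro p
    by_cases hp : φ p = q
    · simp [hp]
    · simp [hp]
  rw [Finset.sum_congr rfl fun p _ => e p, Finset.sum_comm]
  have e2 : ∀ p', ∑ p, (if φ p' = q' then (if φ p = q then h p p' else 0) else 0)
      = if φ p' = q' then K q q' else 0 := by
    intro p'
    by_cases hp : φ p' = q'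
    · simp only [hp, if_true]; rw [hK, hp]
    · simp [hp]
  rw [Finset.sum_congr rfl fun p _ => e2 p, ← Finset.sum_filter, Finset.sum_const, nsmul_eq_mul,
    ← mul_assoc, Nat.card_eq_fintype_card, Fintype.card_subtype]
  rw [Nat.card_eq_fintype_card, Fintype.card_subtype] at hcard
  rw [inv_mul_cancel₀ hcard, one_mul]

open Classical in
/-- Theorem: pushforwards of angle functions along `F ↦ L(F)`.
For a belt polytope `P` and any cone angle `α`, the (extended) interior and exterior
angle functions lie in `I_L(ℱ)`, and `L_* α̌ = ζ_{L₀}`, `L_* α̂' = μ_{L₀}`. -/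
theorem statement13 (d : ℕ) (hd : 0 < d) (P : Set (Euc d))
    (hP : IsBeltPolytope P) (hdim : sdim P = d) (α : ConeAngle d) :
    memIphi (LMap P) (intA α P) ∧
    memIphi (LMap P) (extA α P) ∧
    memIphi (LMap P) (intA' α P) ∧
    (∀ q q' : Flats0 P, pushf (LMap P) (extA α P) q q' = if q ≤ q' then 1 else 0) ∧
    (∀ q q' : Flats0 P, pushf (LMap P) (intA' α P) q q' = mob q q') := by
  obtain ⟨hP, k, z, _, hz⟩ := hP
  have h : Belt P z := by
    intro x y
    rw [← hz]
    exact forall_congr' fun i => (realSign_iff _ _).symm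
  have := finite_faces h
  have := Fintype.ofFinite {F : Set (Euc d) // IsFace P F}
  refine ⟨⟨?_, ?_⟩, ⟨?_, ?_⟩, ⟨?_, ?_⟩, ?_, ?_⟩
  · intro F G hn
    exact if_neg hn
  · intro q G₁ G₂ hG
    obtain ⟨H, rfl⟩ := LMap_surj P q
    have e : ∀ G : {F : Set (Euc d) // IsFace P F},
        ∑ F, (if LMap P F = LMap P H then intA α P F G else 0)
        = (-1) ^ (rkFace G.1 - rkFace H.1) * mob (LMap P H) (LMap P G) := by
      intro G
      rw [← int_mob hP h α, Finset.mul_sum]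
      refine Finset.sum_congr rfl fun F _ => ?_
      by_cases h1 : LMap P F = LMap P H
      · rw [if_pos h1, if_pos h1, intA', rkFace_eq F H h1, ← mul_assoc, ← mul_pow]
        norm_num
      · rw [if_neg h1, if_neg h1, mul_zero]
    rw [finsum_fiber, finsum_fiber, e, e, hG, rkFace_eq _ _ hG]
  · intro F G hn
    exact if_neg hn
  · intro q G₁ G₂ hG
    rw [finsum_fiber, finsum_fiber, ext_col hP h, ext_col hP h, hG]
  · intro F G hn
    exact intA'_not_sub α F G hn
  · intro q G₁ G₂ hG
    rw [finsum_fiber, finsum_fiber, int_mob hP h, int_mob hP h, hG]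
  · exact pushf_eq (LMap P) (LMap_surj P) _ (fun q q' => if q ≤ q' then 1 else 0)
      (fun q G => ext_col hP h α q G)
  · exact pushf_eq (LMap P) (LMap_surj P) _ mob (fun q G => int_mob hP h α q G)

end GramAngles
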